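/- arXiv:1609.05443 — 2 statements merged into one kernel-verified Lean document; each statement's English description precedes it below -/
import Mathlib

section
/- For every 1/2 ≤ ν < 1 and every fixed x > 0, the signaling Green function is a probability density in the time variable: ∫₀^∞ G_s(x,t;ν) dt = 1, the integral being convergent. -/
open Real MeasureTheory Set

/-- The Mainardi function `M_ν(x) = Σ_{n=0}^∞ (−x)^n/(n! · Γ(1 − ν − νn))`. -/
noncomputable def mainardi (ν x : ℝ) : ℝ :=
  ∑' n : ℕ, (-x) ^ n / ((n.factorial : ℝ) * Real.Gamma (1 - ν - ν * n))

/-- The Green function of the signaling problem: `G_s(x,t;ν) = (ν x / t^{ν+1}) · M_ν(x/t^ν)`. -/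
noncomputable def greenSignaling (ν x t : ℝ) : ℝ :=
  (ν * x / t ^ (ν + 1)) * mainardi ν (x / t ^ ν)

/-- The Gamma integral against an exponential with complex rate. -/
lemma integral_rpow_mul_cexp_neg_mul_Ioi {s : ℝ} (hs : 0 < s) {a : ℂ} (ha : 0 < a.re) :
    ∫ t : ℝ in Ioi 0, ((t ^ (s - 1) : ℝ) : ℂ) * Complex.exp (-a * t) =
      Real.Gamma s * a ^ (-s : ℂ) := by
  set w : ℝ → NNReal := fun t => Real.toNNReal (t ^ (s - 1))
  have hw : Measurable w := by fun_prop
  set μ : Measure ℝ := (volume.restrict (Ioi 0)).withDensity (fun t => w t)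
  have hMGF (z : ℂ) : ProbabilityTheory.complexMGF id μ z =
      ∫ t : ℝ in Ioi 0, ((t ^ (s - 1) : ℝ) : ℂ) * Complex.exp (z * t) := by
    rw [ProbabilityTheory.complexMGF, integral_withDensity_eq_integral_smul hw]
    refine setIntegral_congr_fun measurableSet_Ioi fun t ht => ?_
    have h0 : 0 ≤ t ^ (s - 1) := rpow_nonneg (le_of_lt ht) _
    simp [NNReal.smul_def, w, h0]
  have hsub : Iio 0 ⊆ interior (ProbabilityTheory.integrableExpSet id μ) := by
    refine interior_maximal (fun r hr => ?_) isOpen_Iio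
    have hr : r < 0 := hr
    change Integrable _ _
    rw [integrable_withDensity_iff_integrable_coe_smul hw]
    refine (integrableOn_rpow_mul_exp_neg_mul_rpow (s := s - 1) (p := 1) (b := -r) (by linarith)
      one_pos (by linarith)).congr_fun (fun t ht => ?_) measurableSet_Ioi
    have h0 : 0 ≤ t ^ (s - 1) := rpow_nonneg (le_of_lt ht) _
    simp [w, h0]
  set U : Set ℂ := {z : ℂ | z.re < 0}
  have hU : IsOpen U := isOpen_lt Complex.continuous_re continuous_const
  have hf : AnalyticOnNhd ℂ (ProbabilityTheory.complexMGF id μ) U := fun z hz =>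
    ProbabilityTheory.analyticAt_complexMGF (hsub hz)
  have hg : AnalyticOnNhd ℂ (fun z : ℂ => (Real.Gamma s : ℂ) * (-z) ^ (-s : ℂ)) U := by
    refine DifferentiableOn.analyticOnNhd (fun z hz => ?_) hU
    have hz : z.re < 0 := hz
    have : -z ∈ Complex.slitPlane := Or.inl (by simpa using hz)
    exact ((differentiableAt_id.neg.cpow_const (this)).const_mul _).differentiableWithinAt
  have hreal (r : ℝ) (hr : r < 0) : ProbabilityTheory.complexMGF id μ r =
      (Real.Gamma s : ℂ) * (-(r : ℂ)) ^ (-s : ℂ) := by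
    have h := Real.integral_rpow_mul_exp_neg_mul_Ioi hs (neg_pos.2 hr)
    rw [hMGF]
    have h2 : (1 / -r) ^ s * Real.Gamma s = Real.Gamma s * (-r) ^ (-s) := by
      rw [one_div, inv_rpow (by linarith), ← rpow_neg (by linarith), mul_comm]
    rw [h2] at h
    have h3 := congrArg (fun u : ℝ => (u : ℂ)) h
    simp only [← integral_complex_ofReal] at h3
    push_cast at h3
    rw [Complex.ofReal_cpow (by linarith)] at h3
    push_cast at h3
    rw [← h3]
    simp
  have hconv : IsPreconnected U :=
    ((convex_Iio (0 : ℝ)).linear_preimage Complex.reLm).isPreconnected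
  have hEq := hf.eqOn_of_preconnected_of_frequently_eq hg hconv (z₀ := ((-1 : ℝ) : ℂ))
    (by simp [U]) (by
      have h_real : ∃ᶠ (x : ℝ) in nhdsWithin (-1) {-1}ᶜ, ProbabilityTheory.complexMGF id μ x =
          (Real.Gamma s : ℂ) * (-(x : ℂ)) ^ (-s : ℂ) :=
        (((eventually_lt_nhds (by norm_num : (-1 : ℝ) < 0)).filter_mono
          nhdsWithin_le_nhds).mono hreal).frequently
      refine Filter.Tendsto.frequently (Filter.Tendsto.inf ?_ ?_) h_real
      · exact Complex.continuous_ofReal.continuousAt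
      · rw [Filter.tendsto_principal_principal]
        intro x hx
        simpa [-Complex.ofReal_neg] using hx)
  have := hEq (show -a ∈ U by simpa [U] using ha)
  rw [hMGF] at this
  simpa using this

/-- The Gamma integral along a rotated ray, in polar form. -/
lemma integral_rpow_mul_cexp_neg_polar {s k φ : ℝ} (hs : 0 < s) (hk : 0 < k)
    (hφ : φ ∈ Ioo (-(π / 2)) (π / 2)) :
    ∫ t : ℝ in Ioi 0, ((t ^ (s - 1) : ℝ) : ℂ) *
        Complex.exp (-(k * Complex.exp (φ * Complex.I)) * t) =
      Real.Gamma s * ((k ^ (-s) : ℝ) : ℂ) * Complex.exp (-(φ * s) * Complex.I) := by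
  have hre : 0 < ((k : ℂ) * Complex.exp (φ * Complex.I)).re := by
    rw [Complex.re_ofReal_mul, Complex.exp_ofReal_mul_I_re]
    exact mul_pos hk (Real.cos_pos_of_mem_Ioo hφ)
  rw [integral_rpow_mul_cexp_neg_mul_Ioi hs hre, mul_assoc]
  congr 1
  have h0 : Complex.exp (φ * Complex.I) ≠ 0 := Complex.exp_ne_zero _
  have hlog : Complex.log (Complex.exp (φ * Complex.I)) = φ * Complex.I :=
    Complex.log_exp (by simp; linarith [hφ.1, pi_pos]) (by simp; linarith [hφ.2, pi_pos])
  have hk' : (k : ℂ) ≠ 0 := Complex.ofReal_ne_zero.2 hk.ne'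
  rw [Complex.cpow_def_of_ne_zero (mul_ne_zero hk' h0), Complex.log_ofReal_mul hk h0, hlog,
    rpow_def_of_pos hk, Complex.ofReal_exp, ← Complex.exp_add]
  push_cast
  congr 1
  ring

lemma cexp_mul_integral_rpow_mul_cexp_ray {s θ : ℝ} (hs : 0 < s) (hθ : θ ∈ Ioo (π / 2) π) :
    Complex.exp ((θ * s : ℝ) * Complex.I) * ∫ t : ℝ in Ioi 0, ((t ^ (s - 1) : ℝ) : ℂ) *
        Complex.exp (Complex.exp (θ * Complex.I) * t) =
      Real.Gamma s * Complex.exp ((π * s : ℝ) * Complex.I) := by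
  have h := integral_rpow_mul_cexp_neg_polar (φ := θ - π) hs one_pos
    ⟨by linarith [hθ.1], by linarith [hθ.2, pi_pos]⟩
  have h1 : -Complex.exp (((θ - π : ℝ) : ℂ) * Complex.I) = Complex.exp (θ * Complex.I) := by
    push_cast
    rw [sub_mul, Complex.exp_sub, Complex.exp_pi_mul_I]
    ring
  simp only [Complex.ofReal_one, one_mul, h1, one_rpow, mul_one] at h
  rw [h, mul_left_comm, ← Complex.exp_add]
  congr 2
  push_cast
  ring

/-- The integrand of the representation of the Mainardi function along the ray of angle `θ`. -/
noncomputable def rayIntegrand (ν θ x r : ℝ) : ℂ :=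
  Complex.exp (Complex.exp (θ * Complex.I) * r) *
    Complex.exp (-((x * r ^ ν : ℝ) * Complex.exp ((ν * θ : ℝ) * Complex.I)))

lemma norm_cexp_ray (θ r : ℝ) :
    ‖Complex.exp (Complex.exp (θ * Complex.I) * r)‖ = Real.exp (Real.cos θ * r) := by
  rw [Complex.norm_exp, Complex.re_mul_ofReal, Complex.exp_ofReal_mul_I_re]

lemma norm_rayIntegrand (ν θ x r : ℝ) :
    ‖rayIntegrand ν θ x r‖ =
      Real.exp (Real.cos θ * r) * Real.exp (-(x * r ^ ν * Real.cos (ν * θ))) := by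
  rw [rayIntegrand, norm_mul, norm_cexp_ray, Complex.norm_exp, Complex.neg_re,
    Complex.re_ofReal_mul, Complex.exp_ofReal_mul_I_re]

lemma measurable_rayIntegrand (ν θ : ℝ) :
    Measurable (Function.uncurry (rayIntegrand ν θ)) := by
  unfold rayIntegrand Function.uncurry
  fun_prop

lemma integrableOn_exp_mul_exp_rpow {ν c x : ℝ} (hν0 : 0 < ν) (hν1 : ν < 1) (hc : c < 0) :
    IntegrableOn (fun r : ℝ => Real.exp (c * r) * Real.exp (x * r ^ ν)) (Ioi 0) := by
  refine integrable_of_isBigO_exp_neg (b := -c / 2) (by linarith) ?_ ?_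
  · have := Real.continuous_rpow_const hν0.le
    fun_prop
  · refine Asymptotics.IsBigO.of_bound 1 ?_
    have h0 : Filter.Tendsto (fun r : ℝ => x * r ^ (-(1 - ν))) Filter.atTop (nhds (x * 0)) :=
      (tendsto_rpow_neg_atTop (by linarith)).const_mul x
    rw [mul_zero] at h0
    filter_upwards [h0.eventually_lt_const (show 0 < -c / 2 by linarith),
      Filter.eventually_gt_atTop 0] with r hr hr0
    rw [← Real.exp_add, one_mul, Real.norm_eq_abs, Real.norm_eq_abs, Real.abs_exp, Real.abs_exp,
      Real.exp_le_exp]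
    have h1 : r ^ ν = r ^ (-(1 - ν)) * r := by
      rw [← rpow_add_one hr0.ne']; ring_nf
    rw [h1]
    nlinarith

lemma inv_Gamma_neg_eq (s : ℝ) (hs : 0 ≤ s) :
    (Real.Gamma (-s))⁻¹ = Real.Gamma (s + 1) * Real.sin (π * (s + 1)) / π := by
  have h := Real.Gamma_mul_Gamma_one_sub (s + 1)
  have hpos : 0 < Real.Gamma (s + 1) := Real.Gamma_pos_of_pos (by linarith)
  rw [show 1 - (s + 1) = -s by ring] at h
  rw [show Real.Gamma (-s) = (π / Real.sin (π * (s + 1))) / Real.Gamma (s + 1) by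
    rw [← h]; field_simp]
  rw [inv_div, div_div_eq_mul_div]

/-- Termwise integration of the ray integral reproduces the shifted Mainardi series. -/
lemma hasSum_ray {ν θ : ℝ} (hν0 : 0 < ν) (hν1 : ν < 1) (hθ : θ ∈ Ioo (π / 2) π) {x : ℝ}
    (hx : 0 < x) :
    HasSum (fun n : ℕ => (-x) ^ n / ((n.factorial : ℝ) * Real.Gamma (-(ν * n))))
      ((Complex.exp (θ * Complex.I) * ∫ r in Ioi 0, rayIntegrand ν θ x r).im / π) := by
  have hcos : Real.cos θ < 0 :=
    Real.cos_neg_of_pi_div_two_lt_of_lt hθ.1 (by linarith [hθ.2, pi_pos])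
  set b : ℂ := Complex.exp ((ν * θ : ℝ) * Complex.I)
  have hb : ‖b‖ = 1 := Complex.norm_exp_ofReal_mul_I _
  have key : HasSum (fun n : ℕ => ∫ r : ℝ in Ioi 0, Complex.exp (Complex.exp (θ * Complex.I) * r) *
      ((-((x * r ^ ν : ℝ) * b)) ^ n / (n.factorial : ℂ))) (∫ r in Ioi 0, rayIntegrand ν θ x r) := by
    have hsum (r : ℝ) : HasSum (fun n : ℕ => Real.exp (Real.cos θ * r) *
        ((x * r ^ ν) ^ n / (n.factorial : ℝ)))
        (Real.exp (Real.cos θ * r) * Real.exp (x * r ^ ν)) := by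
      rw [Real.exp_eq_exp_ℝ]
      exact (NormedSpace.expSeries_div_hasSum_exp (x * r ^ ν)).mul_left _
    refine hasSum_integral_of_dominated_convergence
      (fun n r => Real.exp (Real.cos θ * r) * ((x * r ^ ν) ^ n / (n.factorial : ℝ))) ?_ ?_ ?_ ?_ ?_
    · intro n
      exact Measurable.aestronglyMeasurable (by fun_prop)
    · intro n
      filter_upwards [ae_restrict_mem measurableSet_Ioi] with r hr
      have h0 : 0 ≤ r ^ ν := rpow_nonneg (le_of_lt hr) _
      rw [norm_mul, norm_cexp_ray, norm_div, norm_pow, norm_neg, norm_mul, hb, Complex.norm_real,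
        Complex.norm_natCast, mul_one, Real.norm_of_nonneg (by positivity)]
    · exact Filter.Eventually.of_forall fun r => (hsum r).summable
    · simp only [fun r => (hsum r).tsum_eq]
      exact integrableOn_exp_mul_exp_rpow hν0 hν1 hcos
    · refine Filter.Eventually.of_forall fun r => ?_
      rw [rayIntegrand]
      have h := (NormedSpace.expSeries_div_hasSum_exp (-((x * r ^ ν : ℝ) * b))).mul_left
        (Complex.exp (Complex.exp (θ * Complex.I) * r))
      rwa [← Complex.exp_eq_exp_ℂ] at h
  have h2 := (Complex.hasSum_im (key.mul_left (Complex.exp (θ * Complex.I)))).div_const π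
  convert! h2 using 1
  ext n
  have hsn : 0 ≤ ν * n := by positivity
  have hterm : ∫ r : ℝ in Ioi 0, Complex.exp (Complex.exp (θ * Complex.I) * r) *
      ((-((x * r ^ ν : ℝ) * b)) ^ n / (n.factorial : ℂ)) =
      ((((-x) ^ n / (n.factorial : ℝ) : ℝ) : ℂ) * b ^ n) * ∫ r : ℝ in Ioi 0,
        ((r ^ (ν * n + 1 - 1) : ℝ) : ℂ) * Complex.exp (Complex.exp (θ * Complex.I) * r) := by
    rw [← integral_const_mul]
    refine setIntegral_congr_fun measurableSet_Ioi fun r hr => ?_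
    have hr : 0 < r := hr
    simp only [add_sub_cancel_right]
    rw [rpow_mul hr.le, rpow_natCast]
    push_cast
    rw [← neg_mul, ← neg_mul, mul_pow, mul_pow]
    ring
  have hbn : Complex.exp (θ * Complex.I) * b ^ n =
      Complex.exp ((θ * (ν * n + 1) : ℝ) * Complex.I) := by
    rw [← Complex.exp_nat_mul, ← Complex.exp_add]
    congr 1
    push_cast
    ring
  rw [hterm, show ∀ p q r s : ℂ, p * ((q * r) * s) = q * ((p * r) * s) by intros; ring, hbn,
    cexp_mul_integral_rpow_mul_cexp_ray (by linarith) hθ, Complex.im_ofReal_mul,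
    Complex.im_ofReal_mul, Complex.exp_ofReal_mul_I_im, ← div_div, div_eq_mul_inv _ (Gamma _),
    inv_Gamma_neg_eq _ hsn]
  ring

lemma hasSum_mul_mainardi_terms {ν θ : ℝ} (hν0 : 0 < ν) (hν1 : ν < 1) (hθ : θ ∈ Ioo (π / 2) π)
    {x : ℝ} (hx : 0 < x) :
    HasSum (fun n : ℕ => ν * x * ((-x) ^ n / ((n.factorial : ℝ) * Real.Gamma (1 - ν - ν * n))))
      ((Complex.exp (θ * Complex.I) * ∫ r in Ioi 0, rayIntegrand ν θ x r).im / π) := by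
  have h := (hasSum_nat_add_iff' 1).2 (hasSum_ray hν0 hν1 hθ hx)
  simp only [Finset.range_one, Finset.sum_singleton, Nat.cast_zero, mul_zero, neg_zero,
    Real.Gamma_zero, div_zero, sub_zero] at h
  convert! h using 1
  ext n
  have hs : -(ν * ((n + 1 : ℕ) : ℝ)) ≠ 0 := by
    have : 0 < ν * ((n + 1 : ℕ) : ℝ) := by positivity
    linarith
  have hG := Real.Gamma_add_one hs
  rw [show 1 - ν - ν * n = -(ν * ((n + 1 : ℕ) : ℝ)) + 1 by push_cast; ring, hG,
    Nat.factorial_succ]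
  push_cast at hs ⊢
  have hn : (n : ℝ) + 1 ≠ 0 := by positivity
  rcases eq_or_ne (Real.Gamma (-(ν * ((n : ℝ) + 1)))) 0 with h0 | h0
  · simp [h0]
  · field_simp
    ring

lemma summable_mainardi {ν x : ℝ} (hν0 : 0 < ν) (hν1 : ν < 1) (hx : 0 < x) :
    Summable fun n : ℕ => (-x) ^ n / ((n.factorial : ℝ) * Real.Gamma (1 - ν - ν * n)) :=
  (summable_mul_left_iff (by positivity : ν * x ≠ 0)).1
    (hasSum_mul_mainardi_terms hν0 hν1 (θ := 3 * π / 4)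
      ⟨by linarith [pi_pos], by linarith [pi_pos]⟩ hx).summable

lemma mainardi_eq_ray {ν θ : ℝ} (hν0 : 0 < ν) (hν1 : ν < 1) (hθ : θ ∈ Ioo (π / 2) π)
    {x : ℝ} (hx : 0 < x) :
    mainardi ν x =
      (Complex.exp (θ * Complex.I) * ∫ r in Ioi 0, rayIntegrand ν θ x r).im / (π * ν * x) := by
  have h := (hasSum_mul_mainardi_terms hν0 hν1 hθ hx).tsum_eq
  rw [tsum_mul_left] at h
  have hpi := pi_pos
  rw [mainardi, eq_div_iff (by positivity)]
  rw [eq_div_iff hpi.ne'] at h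
  linear_combination h

lemma measurable_mainardi (ν : ℝ) : Measurable (mainardi ν) := by
  unfold mainardi
  exact Measurable.tsum fun n => by fun_prop

/-- A common ray on which both exponential factors of the ray integrand decay. -/
lemma exists_ray_angle {ν : ℝ} (hν0 : 0 < ν) (hν1 : ν < 1) :
    ∃ θ ∈ Ioo (π / 2) π, ν * θ < π / 2 := by
  have hpi := pi_pos
  have h : π / 2 < min π (π / 2 / ν) :=
    lt_min (by linarith) ((lt_div_iff₀ hν0).2 (by nlinarith))
  obtain ⟨θ, h1, h2⟩ := exists_between h
  refine ⟨θ, ⟨h1, h2.trans_le (min_le_left _ _)⟩, ?_⟩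
  have := (lt_div_iff₀ hν0).1 (h2.trans_le (min_le_right _ _))
  linarith

lemma exists_abs_mainardi_le_const {ν : ℝ} (hν0 : 0 < ν) (hν1 : ν < 1) :
    ∃ C, ∀ x ∈ Ioc (0 : ℝ) 1, |mainardi ν x| ≤ C := by
  refine ⟨∑' n : ℕ, ‖(-1 : ℝ) ^ n / ((n.factorial : ℝ) * Real.Gamma (1 - ν - ν * n))‖,
    fun x hx => ?_⟩
  rw [← Real.norm_eq_abs]
  refine tsum_of_norm_bounded (summable_mainardi hν0 hν1 one_pos).norm.hasSum fun n => ?_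
  rw [norm_div, norm_div, norm_pow, norm_pow]
  have : ‖-x‖ ≤ ‖(-1 : ℝ)‖ := by
    rw [norm_neg, norm_neg, norm_one, Real.norm_of_nonneg hx.1.le]
    exact hx.2
  gcongr

lemma exists_abs_mainardi_le_rpow {ν : ℝ} (hν0 : 0 < ν) (hν1 : ν < 1) :
    ∃ C, ∀ x : ℝ, 1 ≤ x → |mainardi ν x| ≤ C * x ^ (-2 : ℝ) := by
  obtain ⟨θ, hθ, hνθ⟩ := exists_ray_angle hν0 hν1
  have hpi := pi_pos
  have hνθ0 : 0 < ν * θ := mul_pos hν0 (by linarith [hθ.1])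
  have hc : 0 < Real.cos (ν * θ) := Real.cos_pos_of_mem_Ioo ⟨by linarith, hνθ⟩
  have hcos : Real.cos θ < 0 := Real.cos_neg_of_pi_div_two_lt_of_lt hθ.1 (by linarith [hθ.2])
  set c := Real.cos (ν * θ)
  refine ⟨c ^ (-1 / ν) * Real.Gamma (1 / ν + 1) / (π * ν), fun x hx => ?_⟩
  have hx0 : 0 < x := by linarith
  have hbound : ‖∫ r in Ioi 0, rayIntegrand ν θ x r‖ ≤
      (c * x) ^ (-1 / ν) * Real.Gamma (1 / ν + 1) := by
    rw [← integral_exp_neg_mul_rpow hν0 (mul_pos hc hx0)]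
    refine norm_integral_le_of_norm_le ?_ ?_
    · simpa [IntegrableOn] using integrableOn_rpow_mul_exp_neg_mul_rpow (s := 0) (by norm_num) hν0
        (mul_pos hc hx0)
    · filter_upwards [ae_restrict_mem measurableSet_Ioi] with r hr
      have hr : 0 < r := hr
      rw [norm_rayIntegrand, ← Real.exp_add, Real.exp_le_exp]
      nlinarith
  have hΓ : 0 < Real.Gamma (1 / ν + 1) := Real.Gamma_pos_of_pos (by positivity)
  have hpow : x ^ (-1 / ν) ≤ x ^ (-1 : ℝ) := by
    refine rpow_le_rpow_of_exponent_le hx ?_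
    rw [div_le_iff₀ hν0]
    linarith
  rw [mainardi_eq_ray hν0 hν1 hθ hx0, abs_div, abs_of_pos (by positivity : 0 < π * ν * x),
    div_le_iff₀ (by positivity)]
  calc _ ≤ ‖Complex.exp (θ * Complex.I) * ∫ r in Ioi 0, rayIntegrand ν θ x r‖ :=
        Complex.abs_im_le_norm _
    _ ≤ (c * x) ^ (-1 / ν) * Real.Gamma (1 / ν + 1) := by
        rwa [norm_mul, Complex.norm_exp_ofReal_mul_I, one_mul]
    _ ≤ c ^ (-1 / ν) * x ^ (-1 : ℝ) * Real.Gamma (1 / ν + 1) := by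
        rw [mul_rpow hc.le hx0.le]
        gcongr
    _ = _ := by
        rw [show (-1 : ℝ) = -2 + 1 by norm_num, rpow_add_one hx0.ne']
        field_simp

/-- An integrable majorant, uniform in `ε`, for the Mellin integrands of the Mainardi function. -/
lemma exists_integrable_bound_rpow_mul_mainardi {ν : ℝ} (hν0 : 0 < ν) (hν1 : ν < 1) :
    ∃ g : ℝ → ℝ, IntegrableOn g (Ioi 0) ∧
      ∀ ε ∈ Icc (0 : ℝ) (1 / 2), ∀ x ∈ Ioi (0 : ℝ), ‖x ^ ε * mainardi ν x‖ ≤ g x := by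
  obtain ⟨A, hA⟩ := exists_abs_mainardi_le_const hν0 hν1
  obtain ⟨B, hB⟩ := exists_abs_mainardi_le_rpow hν0 hν1
  refine ⟨fun x => if x ≤ 1 then A else B * x ^ (-3 / 2 : ℝ), ?_, fun ε hε x hx => ?_⟩
  · rw [← Ioc_union_Ioi_eq_Ioi zero_le_one]
    refine IntegrableOn.union ?_ ?_
    · refine (integrableOn_const (C := A) (by simp) (by simp)).congr_fun (fun x hx => ?_)
        measurableSet_Ioc
      simp [hx.2]
    · refine IntegrableOn.congr_fun (f := fun x => B * x ^ (-3 / 2 : ℝ))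
        ((integrableOn_Ioi_rpow_of_lt (by norm_num) one_pos).const_mul B) (fun x hx => ?_)
        measurableSet_Ioi
      have hx : 1 < x := hx
      simp [not_le.2 hx]
  · have hx : 0 < x := hx
    rw [norm_mul, Real.norm_of_nonneg (rpow_nonneg hx.le _), Real.norm_eq_abs]
    dsimp only
    split_ifs with h
    · have h1 : x ^ ε ≤ 1 := rpow_le_one hx.le h hε.1
      calc x ^ ε * |mainardi ν x| ≤ 1 * |mainardi ν x| := by gcongr
        _ ≤ A := by rw [one_mul]; exact hA x ⟨hx, h⟩
    · have h1 : 1 ≤ x := (not_le.1 h).le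
      calc x ^ ε * |mainardi ν x| ≤ x ^ (1 / 2 : ℝ) * (B * x ^ (-2 : ℝ)) := by
            gcongr
            · exact hε.2
            · exact hB x h1
        _ = B * x ^ (-3 / 2 : ℝ) := by
            rw [mul_left_comm, ← rpow_add hx]
            norm_num

lemma integrable_rpow_mul_rayIntegrand {ν θ ε : ℝ} (hν0 : 0 < ν) (hθ : θ ∈ Ioo (π / 2) π)
    (hνθ : ν * θ < π / 2) (hε : 0 < ε) (hνε : ν * ε < 1) :
    Integrable (Function.uncurry fun x r : ℝ => ((x ^ (ε - 1) : ℝ) : ℂ) * rayIntegrand ν θ x r)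
      ((volume.restrict (Ioi 0)).prod (volume.restrict (Ioi 0))) := by
  have hpi := pi_pos
  have hνθ0 : 0 < ν * θ := mul_pos hν0 (by linarith [hθ.1])
  have hc : 0 < Real.cos (ν * θ) := Real.cos_pos_of_mem_Ioo ⟨by linarith, hνθ⟩
  have hcos : Real.cos θ < 0 := Real.cos_neg_of_pi_div_two_lt_of_lt hθ.1 (by linarith [hθ.2])
  set c := Real.cos (ν * θ)
  have hmeas : Measurable (Function.uncurry fun x r : ℝ =>
      ((x ^ (ε - 1) : ℝ) : ℂ) * rayIntegrand ν θ x r) :=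
    (by fun_prop : Measurable fun p : ℝ × ℝ => ((p.1 ^ (ε - 1) : ℝ) : ℂ)).mul
      (measurable_rayIntegrand ν θ)
  have hnorm (x r : ℝ) (hx : 0 < x) :
      ‖((x ^ (ε - 1) : ℝ) : ℂ) * rayIntegrand ν θ x r‖ =
        Real.exp (Real.cos θ * r) * (x ^ (ε - 1) * Real.exp (-(c * r ^ ν * x))) := by
    rw [norm_mul, norm_rayIntegrand, Complex.norm_real,
      Real.norm_of_nonneg (rpow_nonneg hx.le _), show x * r ^ ν * Real.cos (ν * θ) = c * r ^ ν * x by ring]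
    ring
  rw [integrable_prod_iff' hmeas.aestronglyMeasurable]
  constructor
  · filter_upwards [ae_restrict_mem measurableSet_Ioi] with r hr
    have hr : 0 < r := hr
    have hk : 0 < c * r ^ ν := mul_pos hc (rpow_pos_of_pos hr _)
    have hm : AEStronglyMeasurable (fun x : ℝ => ((x ^ (ε - 1) : ℝ) : ℂ) * rayIntegrand ν θ x r)
        (volume.restrict (Ioi 0)) :=
      (hmeas.comp (measurable_prodMk_right (y := r))).aestronglyMeasurable
    refine (integrable_norm_iff hm).1 ?_
    refine IntegrableOn.congr_fun (f := fun x => Real.exp (Real.cos θ * r) *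
      (x ^ (ε - 1) * Real.exp (-(c * r ^ ν) * x ^ (1 : ℝ))))
      ((integrableOn_rpow_mul_exp_neg_mul_rpow (by linarith) one_pos hk).const_mul _) (fun x hx => ?_)
      measurableSet_Ioi
    simp only [hnorm x r hx, rpow_one, neg_mul]
  · refine IntegrableOn.congr_fun (f := fun r => c ^ (-ε) * Real.Gamma ε *
      (r ^ (-(ν * ε)) * Real.exp (-(-Real.cos θ) * r ^ (1 : ℝ))))
      ((integrableOn_rpow_mul_exp_neg_mul_rpow (by linarith) one_pos (by linarith)).const_mul _)
      (fun r hr => ?_) measurableSet_Ioi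
    have hr : 0 < r := hr
    have hk : 0 < c * r ^ ν := mul_pos hc (rpow_pos_of_pos hr _)
    simp only [Function.uncurry]
    rw [setIntegral_congr_fun measurableSet_Ioi (fun x hx => hnorm x r hx), integral_const_mul,
      Real.integral_rpow_mul_exp_neg_mul_Ioi hε hk, one_div, inv_rpow hk.le, ← rpow_neg hk.le,
      mul_rpow hc.le (rpow_nonneg hr.le _), ← rpow_mul hr.le, rpow_one, neg_neg, mul_neg]
    ring

/-- The Mellin transform of the Mainardi function. -/
lemma integral_rpow_mul_mainardi {ν ε : ℝ} (hν0 : 0 < ν) (hν1 : ν < 1) (hε : 0 < ε)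
    (hνε : ν * ε < 1) :
    ∫ x in Ioi (0 : ℝ), x ^ ε * mainardi ν x = Real.Gamma (ε + 1) / Real.Gamma (ν * ε + 1) := by
  obtain ⟨θ, hθ, hνθ⟩ := exists_ray_angle hν0 hν1
  have hpi := pi_pos
  have hνθ0 : 0 < ν * θ := mul_pos hν0 (by linarith [hθ.1])
  have hνε0 : 0 < ν * ε := mul_pos hν0 hε
  have hK := integrable_rpow_mul_rayIntegrand hν0 hθ hνθ hε hνε
  have hJ := hK.integral_prod_left.const_mul (Complex.exp (θ * Complex.I))
  have hinner (r : ℝ) (hr : r ∈ Ioi (0 : ℝ)) :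
      ∫ x in Ioi (0 : ℝ), ((x ^ (ε - 1) : ℝ) : ℂ) * rayIntegrand ν θ x r =
        (Real.Gamma ε * Complex.exp ((-(ν * θ * ε) : ℝ) * Complex.I)) *
          (((r ^ (1 - ν * ε - 1) : ℝ) : ℂ) * Complex.exp (Complex.exp (θ * Complex.I) * r)) := by
    have hr : 0 < r := hr
    have h := integral_rpow_mul_cexp_neg_polar (φ := ν * θ) hε (rpow_pos_of_pos hr ν)
      ⟨by linarith, hνθ⟩
    rw [← rpow_mul hr.le] at h
    rw [show 1 - ν * ε - 1 = ν * -ε by ring]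
    calc _ = Complex.exp (Complex.exp (θ * Complex.I) * r) * ∫ t : ℝ in Ioi 0,
            ((t ^ (ε - 1) : ℝ) : ℂ) *
            Complex.exp (-((r ^ ν : ℝ) * Complex.exp ((ν * θ : ℝ) * Complex.I)) * t) := by
          rw [← integral_const_mul]
          congr 1 with x
          rw [rayIntegrand, mul_left_comm]
          congr 3
          push_cast
          ring
      _ = _ := by
          rw [h]
          push_cast
          ring_nf
  have hval : Complex.exp (θ * Complex.I) * ∫ x in Ioi (0 : ℝ), ∫ r in Ioi (0 : ℝ),
      ((x ^ (ε - 1) : ℝ) : ℂ) * rayIntegrand ν θ x r =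
      (Real.Gamma ε * Real.Gamma (1 - ν * ε) : ℝ) *
        Complex.exp ((π * (1 - ν * ε) : ℝ) * Complex.I) := by
    rw [integral_integral_swap hK, setIntegral_congr_fun measurableSet_Ioi hinner,
      integral_const_mul, Complex.ofReal_mul, mul_assoc (Real.Gamma ε : ℂ) (Real.Gamma _ : ℂ),
      ← cexp_mul_integral_rpow_mul_cexp_ray (by linarith : 0 < 1 - ν * ε) hθ,
      show ((θ * (1 - ν * ε) : ℝ) : ℂ) * Complex.I =
        θ * Complex.I + (-(ν * θ * ε) : ℝ) * Complex.I by push_cast; ring, Complex.exp_add]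
    ring
  have hpoint (x : ℝ) (hx : x ∈ Ioi (0 : ℝ)) : x ^ ε * mainardi ν x =
      (π * ν)⁻¹ * (Complex.exp (θ * Complex.I) * ∫ r in Ioi (0 : ℝ),
        ((x ^ (ε - 1) : ℝ) : ℂ) * rayIntegrand ν θ x r).im := by
    have hx : 0 < x := hx
    rw [mainardi_eq_ray hν0 hν1 hθ hx, integral_const_mul, mul_left_comm, Complex.im_ofReal_mul,
      rpow_sub_one hx.ne']
    field_simp
  have him := integral_im hJ
  simp only [RCLike.im_eq_complex_im, integral_const_mul] at him
  rw [setIntegral_congr_fun measurableSet_Ioi hpoint, integral_const_mul]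
  have him' : ∫ x in Ioi (0 : ℝ), (Complex.exp (θ * Complex.I) * ∫ r in Ioi (0 : ℝ),
        ((x ^ (ε - 1) : ℝ) : ℂ) * rayIntegrand ν θ x r).im =
      (Complex.exp (θ * Complex.I) * ∫ x in Ioi (0 : ℝ), ∫ r in Ioi (0 : ℝ),
        ((x ^ (ε - 1) : ℝ) : ℂ) * rayIntegrand ν θ x r).im := him
  have hsin : 0 < Real.sin (π * (ν * ε)) :=
    Real.sin_pos_of_pos_of_lt_pi (by positivity) (by nlinarith)
  have hrefl := Real.Gamma_mul_Gamma_one_sub (ν * ε)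
  have hΓ : 0 < Real.Gamma (ν * ε) := Real.Gamma_pos_of_pos hνε0
  rw [him', hval, Complex.im_ofReal_mul, Complex.exp_ofReal_mul_I_im,
    show π * (1 - ν * ε) = π - π * (ν * ε) by ring, Real.sin_pi_sub,
    Real.Gamma_add_one hε.ne', Real.Gamma_add_one hνε0.ne']
  rw [eq_div_iff hsin.ne'] at hrefl
  field_simp
  rw [← mul_assoc] at hrefl
  linear_combination hrefl

lemma integrableOn_mainardi {ν : ℝ} (hν0 : 0 < ν) (hν1 : ν < 1) :
    IntegrableOn (mainardi ν) (Ioi 0) := by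
  obtain ⟨g, hg, hbound⟩ := exists_integrable_bound_rpow_mul_mainardi hν0 hν1
  refine hg.mono' (measurable_mainardi ν).aestronglyMeasurable ?_
  filter_upwards [ae_restrict_mem measurableSet_Ioi] with x hx
  simpa using hbound 0 (by norm_num) x hx

lemma integral_mainardi {ν : ℝ} (hν0 : 0 < ν) (hν1 : ν < 1) :
    ∫ x in Ioi (0 : ℝ), mainardi ν x = 1 := by
  obtain ⟨g, hg, hbound⟩ := exists_integrable_bound_rpow_mul_mainardi hν0 hν1
  have hmem : ∀ᶠ ε : ℝ in nhdsWithin 0 (Ioi 0), ε ∈ Ioo (0 : ℝ) (1 / 2) :=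
    Ioo_mem_nhdsGT (by norm_num)
  have h1 : Filter.Tendsto (fun ε : ℝ => ∫ x in Ioi (0 : ℝ), x ^ ε * mainardi ν x)
      (nhdsWithin 0 (Ioi 0)) (nhds (∫ x in Ioi (0 : ℝ), mainardi ν x)) := by
    refine tendsto_integral_filter_of_dominated_convergence g ?_ ?_ hg ?_
    · exact Filter.Eventually.of_forall fun ε =>
        ((measurable_id.pow_const ε).mul (measurable_mainardi ν)).aestronglyMeasurable
    · filter_upwards [hmem] with ε hε
      filter_upwards [ae_restrict_mem measurableSet_Ioi] with x hx
      exact hbound ε ⟨hε.1.le, hε.2.le⟩ x hx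
    · filter_upwards [ae_restrict_mem measurableSet_Ioi] with x hx
      have hx : 0 < x := hx
      have h : ContinuousAt (fun ε : ℝ => x ^ ε * mainardi ν x) 0 :=
        (Real.continuousAt_const_rpow hx.ne').mul_const _
      simpa using h.tendsto.mono_left (nhdsWithin_le_nhds (s := Ioi 0))
  have h2 : Filter.Tendsto (fun ε : ℝ => Real.Gamma (ε + 1) / Real.Gamma (ν * ε + 1))
      (nhdsWithin 0 (Ioi 0)) (nhds 1) := by
    have hΓ : ContinuousAt Real.Gamma 1 :=
      (Real.differentiableOn_Gamma_Ioi.differentiableAt (Ioi_mem_nhds one_pos)).continuousAt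
    have h : ContinuousAt (fun ε : ℝ => Real.Gamma (ε + 1) / Real.Gamma (ν * ε + 1)) 0 := by
      refine ContinuousAt.div ?_ ?_ (by simp)
      · exact ContinuousAt.comp (g := Real.Gamma) (by simpa using hΓ) (by fun_prop)
      · exact ContinuousAt.comp (g := Real.Gamma) (by simpa using hΓ) (by fun_prop)
    simpa using h.tendsto.mono_left (nhdsWithin_le_nhds (s := Ioi 0))
  refine tendsto_nhds_unique h1 (h2.congr' ?_)
  filter_upwards [hmem] with ε hε
  exact (integral_rpow_mul_mainardi hν0 hν1 hε.1 (by nlinarith [hε.1, hε.2])).symm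

lemma greenSignaling_eq {ν x t : ℝ} (hν0 : 0 < ν) (ht : 0 < t) :
    greenSignaling ν x t =
      (|-ν| * t ^ (-ν - 1)) • (x * mainardi ν (x * t ^ (-ν))) := by
  rw [greenSignaling, abs_neg, abs_of_pos hν0, show -ν - 1 = -(ν + 1) by ring, rpow_neg ht.le,
    rpow_neg ht.le, smul_eq_mul, div_eq_mul_inv, div_eq_mul_inv]
  ring

theorem greenSignaling_time_pdf (ν : ℝ) (hν0 : 1 / 2 ≤ ν) (hν1 : ν < 1)
    (x : ℝ) (hx : 0 < x) :
    IntegrableOn (fun t : ℝ => greenSignaling ν x t) (Ioi 0) ∧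
    ∫ t in Ioi (0 : ℝ), greenSignaling ν x t = 1 := by
  have hν : 0 < ν := by linarith
  have hEq : EqOn (fun t : ℝ => greenSignaling ν x t)
      (fun t => (|-ν| * t ^ (-ν - 1)) • (x * mainardi ν (x * t ^ (-ν)))) (Ioi 0) :=
    fun t ht => greenSignaling_eq hν ht
  constructor
  · rw [integrableOn_congr_fun hEq measurableSet_Ioi,
      integrableOn_Ioi_comp_rpow_iff (fun y => x * mainardi ν (x * y)) (neg_ne_zero.2 hν.ne')]
    refine Integrable.const_mul ?_ x
    refine (integrableOn_Ioi_comp_mul_left_iff (mainardi ν) 0 hx).2 ?_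
    rw [mul_zero]
    exact integrableOn_mainardi hν hν1
  · rw [setIntegral_congr_fun measurableSet_Ioi hEq,
      integral_comp_rpow_Ioi (fun y => x * mainardi ν (x * y)) (neg_ne_zero.2 hν.ne'),
      integral_const_mul, integral_comp_mul_left_Ioi _ _ hx, mul_zero, integral_mainardi hν hν1]
    simp [hx.ne']
end

section
/- For every 1/2 ≤ ν < 1 and every real x, the Mainardi function admits the cosine-transform representation (1/2) · M_ν(|x|) = (1/π) · ∫₀^∞ E_{2ν}(−τ²) · cos(xτ) dτ, the integral being convergent, where E_{2ν} is the Mittag-Leffler function of order 2ν. -/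
open Real MeasureTheory Set

/-- The (real) Mittag-Leffler function `E_α(z) = Σ_{n=0}^∞ z^n/Γ(αn + 1)`. -/
noncomputable def mittagLeffler (α z : ℝ) : ℝ :=
  ∑' n : ℕ, z ^ n / Real.Gamma (α * n + 1)

open Filter Topology

lemma norm_cexp_cexp_add_mul (z u y : ℝ) :
    ‖Complex.exp (Complex.exp (u + y * Complex.I) + z * (u + y * Complex.I))‖ =
      Real.exp (Real.exp u * Real.cos y + z * u) := by
  rw [Complex.norm_exp]
  simp [Complex.exp_re]

lemma integrable_exp_neg_mul_exp_add_mul {c z : ℝ} (hc : 0 < c) (hz : 0 < z) :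
    Integrable (fun u : ℝ => Real.exp (-c * Real.exp u + z * u)) := by
  have h := integrableOn_rpow_mul_exp_neg_mul_rpow (p := 1) (s := z - 1) (b := c)
    (by linarith) one_pos hc
  rw [← Real.range_exp, ← image_univ, integrableOn_image_iff_integrableOn_abs_deriv_smul
    MeasurableSet.univ (fun x _ => (Real.hasDerivAt_exp x).hasDerivWithinAt)
    (Real.exp_injective.injOn), integrableOn_univ] at h
  refine h.congr (Eventually.of_forall fun u => ?_)
  simp only [abs_of_pos (Real.exp_pos u), smul_eq_mul, Real.rpow_one, ← Real.exp_mul]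
  rw [← Real.exp_add, ← Real.exp_add]
  congr 1; ring

lemma integral_exp_neg_exp_add_mul {z : ℝ} (hz : 0 < z) :
    ∫ u : ℝ, Real.exp (-Real.exp u + z * u) = Real.Gamma z := by
  rw [Real.Gamma_eq_integral hz, ← Real.range_exp, ← image_univ,
    integral_image_eq_integral_abs_deriv_smul
    MeasurableSet.univ (fun x _ => (Real.hasDerivAt_exp x).hasDerivWithinAt)
    (Real.exp_injective.injOn), setIntegral_univ]
  congr 1
  ext u
  simp only [abs_of_pos (Real.exp_pos u), smul_eq_mul, ← Real.exp_mul]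
  rw [← Real.exp_add, ← Real.exp_add]
  congr 1; ring

lemma integrableOn_Ioi_exp_neg_mul_exp_add_mul {c : ℝ} (hc : 0 < c) (z R : ℝ) :
    IntegrableOn (fun u : ℝ => Real.exp (-c * Real.exp u + z * u)) (Ioi R) := by
  refine Integrable.mono' (g := fun u => Real.exp ((z - (|z| + 1)) * R) *
    Real.exp (-c * Real.exp u + (|z| + 1) * u)) ?_ (by fun_prop) ?_
  · exact ((integrable_exp_neg_mul_exp_add_mul hc (by positivity)).const_mul _).integrableOn
  · filter_upwards [ae_restrict_mem measurableSet_Ioi] with u hu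
    rw [Real.norm_eq_abs, abs_of_pos (Real.exp_pos _), ← Real.exp_add, Real.exp_le_exp]
    have : z ≤ |z| := le_abs_self z
    have hu' : R < u := hu
    nlinarith

lemma tendsto_exp_neg_mul_exp_add_mul_atBot {c z : ℝ} (hc : 0 < c) (hz : 0 < z) :
    Tendsto (fun u : ℝ => Real.exp (-c * Real.exp u + z * u)) atBot (𝓝 0) := by
  have h : Tendsto (fun u : ℝ => Real.exp (z * u)) atBot (𝓝 0) :=
    Real.tendsto_exp_atBot.comp (tendsto_id.const_mul_atBot hz)
  refine squeeze_zero (fun u => (Real.exp_pos _).le) (fun u => ?_) h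
  rw [Real.exp_le_exp]
  nlinarith [Real.exp_pos u]

lemma tendsto_exp_neg_mul_exp_add_mul_atTop {c : ℝ} (hc : 0 < c) (z : ℝ) :
    Tendsto (fun u : ℝ => Real.exp (-c * Real.exp u + z * u)) atTop (𝓝 0) := by
  have h := (tendsto_rpow_mul_exp_neg_mul_atTop_nhds_zero z c hc).comp Real.tendsto_exp_atTop
  refine h.congr fun u => ?_
  simp only [Function.comp, ← Real.exp_mul]
  rw [← Real.exp_add]
  congr 1; ring

/-- Horizontal line integrals of a holomorphic function decaying at both ends of a strip agree. -/
lemma integral_horizontal_eq_of_tendsto_zero {f : ℂ → ℂ} {a b : ℝ} (hab : a ≤ b)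
    (hf : ∀ w : ℂ, w.im ∈ Icc a b → DifferentiableAt ℂ f w) {B : ℝ → ℝ}
    (hB : ∀ u : ℝ, ∀ y ∈ Icc a b, ‖f (u + y * Complex.I)‖ ≤ B u)
    (hbot : Tendsto B atBot (𝓝 0)) (htop : Tendsto B atTop (𝓝 0))
    (ha : Integrable fun u : ℝ => f (u + a * Complex.I))
    (hb : Integrable fun u : ℝ => f (u + b * Complex.I)) :
    ∫ u : ℝ, f (u + a * Complex.I) = ∫ u : ℝ, f (u + b * Complex.I) := by
  have hrect : ∀ N : ℝ, (∫ u in (-N)..N, f (u + a * Complex.I)) -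
      (∫ u in (-N)..N, f (u + b * Complex.I)) =
      Complex.I • (∫ y in a..b, f ((-N : ℝ) + y * Complex.I)) -
      Complex.I • (∫ y in a..b, f (N + y * Complex.I)) := by
    intro N
    have h := Complex.integral_boundary_rect_eq_zero_of_differentiableOn f
      ((-N : ℝ) + a * Complex.I) (N + b * Complex.I) (by
        intro w hw
        refine (hf w ?_).differentiableWithinAt
        have := hw.2
        simpa [uIcc_of_le hab] using this)
    simp only [Complex.add_re, Complex.ofReal_re, Complex.mul_re, Complex.I_re, mul_zero,
      Complex.ofReal_im, Complex.I_im, mul_one, sub_self, add_zero, Complex.add_im,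
      Complex.mul_im, zero_add] at h
    linear_combination h
  have hside : ∀ u : ℝ, ‖∫ y in a..b, f (u + y * Complex.I)‖ ≤ B u * |b - a| := fun u =>
    intervalIntegral.norm_integral_le_of_norm_le_const fun y hy => by
      rw [uIoc_of_le hab] at hy
      exact hB u y ⟨hy.1.le, hy.2⟩
  have h0 : ∀ l : Filter ℝ, Tendsto B l (𝓝 0) →
      Tendsto (fun u : ℝ => Complex.I • ∫ y in a..b, f (u + y * Complex.I)) l (𝓝 0) := by
    intro l hl
    have h1 : Tendsto (fun u => B u * |b - a|) l (𝓝 0) := by simpa using hl.mul_const |b - a|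
    have := squeeze_zero_norm hside h1
    simpa using this.const_smul Complex.I
  have hL := (intervalIntegral_tendsto_integral ha tendsto_neg_atTop_atBot tendsto_id).sub
    (intervalIntegral_tendsto_integral hb tendsto_neg_atTop_atBot tendsto_id)
  have hR := ((h0 _ hbot).comp tendsto_neg_atTop_atBot).sub (h0 _ htop)
  have := tendsto_nhds_unique (hL.congr fun N => by simpa using hrect N)
    (hR.congr fun N => by simp)
  rw [sub_zero] at this
  exact sub_eq_zero.mp this

lemma cos_le_of_mem_Icc {φ y : ℝ} (hφ : π / 2 < φ) (hy : y ∈ Icc φ π) :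
    Real.cos y ≤ Real.cos φ :=
  Real.cos_le_cos_of_nonneg_of_le_pi (by linarith [Real.pi_pos]) hy.2 hy.1

lemma integrable_cexp_cexp_add_mul {φ z : ℝ} (hφ : Real.cos φ < 0) (hz : 0 < z) :
    Integrable fun u : ℝ => Complex.exp (Complex.exp (u + φ * Complex.I) +
      z * (u + φ * Complex.I)) := by
  have h := integrable_exp_neg_mul_exp_add_mul (neg_pos.mpr hφ) hz
  refine h.mono' (by fun_prop) (Eventually.of_forall fun u => ?_)
  rw [norm_cexp_cexp_add_mul]
  refine le_of_eq ?_
  congr 1; ring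

/-- Euler's integral along the ray of argument `φ`, in logarithmic coordinates. -/
lemma integral_cexp_cexp_add_mul {φ z : ℝ} (hφ : π / 2 < φ) (hφ' : φ ≤ π) (hz : 0 < z) :
    ∫ u : ℝ, Complex.exp (Complex.exp (u + φ * Complex.I) + z * (u + φ * Complex.I)) =
      Real.Gamma z * Complex.exp (z * π * Complex.I) := by
  have hc : Real.cos φ < 0 :=
    Real.cos_neg_of_pi_div_two_lt_of_lt hφ (by linarith [Real.pi_pos])
  rw [integral_horizontal_eq_of_tendsto_zero
    (f := fun w => Complex.exp (Complex.exp w + z * w)) hφ' (fun w _ => by fun_prop)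
    (B := fun u => Real.exp (-(-Real.cos φ) * Real.exp u + z * u)) ?_
    (tendsto_exp_neg_mul_exp_add_mul_atBot (neg_pos.mpr hc) hz)
    (tendsto_exp_neg_mul_exp_add_mul_atTop (neg_pos.mpr hc) z)
    (integrable_cexp_cexp_add_mul hc hz) (integrable_cexp_cexp_add_mul (by simp) hz)]
  · rw [← integral_exp_neg_exp_add_mul hz, ← integral_complex_ofReal, ← integral_mul_const]
    congr 1
    ext u
    rw [Complex.ofReal_exp, ← Complex.exp_add, Complex.exp_add_pi_mul_I]
    congr 1
    push_cast
    ring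
  · intro u y hy
    rw [norm_cexp_cexp_add_mul, Real.exp_le_exp]
    nlinarith [cos_le_of_mem_Icc hφ hy, Real.exp_pos u]

lemma Gamma_mul_sin_eq_pi_div (z : ℝ) (hz : 0 < z) :
    Real.Gamma z * Real.sin (π * z) = π / Real.Gamma (1 - z) := by
  have h := Real.Gamma_mul_Gamma_one_sub z
  have hG := Real.Gamma_pos_of_pos hz
  by_cases hs : Real.sin (π * z) = 0
  · rw [hs, div_zero, mul_eq_zero] at h
    rcases h with h | h
    · exact absurd h hG.ne'
    · rw [hs, h]; simp
  · have h1 : Real.Gamma (1 - z) ≠ 0 := by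
      intro h0
      rw [h0, mul_zero] at h
      exact (div_ne_zero Real.pi_ne_zero hs) h.symm
    rw [eq_div_iff hs] at h
    rw [eq_div_iff h1]
    linear_combination h

lemma im_integral_cexp_cexp_add_mul {φ z : ℝ} (hφ : π / 2 < φ) (hφ' : φ ≤ π) (hz : 0 < z) :
    (∫ u : ℝ, Complex.exp (Complex.exp (u + φ * Complex.I) + z * (u + φ * Complex.I))).im =
      π / Real.Gamma (1 - z) := by
  rw [integral_cexp_cexp_add_mul hφ hφ' hz, ← Gamma_mul_sin_eq_pi_div z hz, Complex.im_ofReal_mul,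
    ← Complex.ofReal_mul, Complex.exp_ofReal_mul_I_im, mul_comm z]

lemma exists_mul_exp_mul_le {ν : ℝ} (hν : 0 < ν) (hν1 : ν < 1) {c : ℝ} (hc : 0 < c) {a : ℝ}
    (ha : 0 ≤ a) : ∃ K : ℝ, ∀ u : ℝ, a * Real.exp (ν * u) ≤ K + c * Real.exp u := by
  refine ⟨a * Real.exp (ν * (a / c / (1 - ν))), fun u => ?_⟩
  have h1ν : 0 < 1 - ν := by linarith
  rcases le_total u (a / c / (1 - ν)) with hu | hu
  · have : Real.exp (ν * u) ≤ Real.exp (ν * (a / c / (1 - ν))) := by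
      rw [Real.exp_le_exp]; gcongr
    nlinarith [Real.exp_pos u]
  · have h2 : a / c ≤ Real.exp ((1 - ν) * u) := by
      rw [div_le_iff₀ h1ν] at hu
      linarith [Real.add_one_le_exp ((1 - ν) * u)]
    rw [div_le_iff₀ hc] at h2
    have h3 : Real.exp u = Real.exp ((1 - ν) * u) * Real.exp (ν * u) := by
      rw [← Real.exp_add]; congr 1; ring
    have h4 : a * Real.exp (ν * u) ≤ c * Real.exp u := by
      rw [h3]; nlinarith [Real.exp_pos (ν * u)]
    have : 0 ≤ a * Real.exp (ν * (a / c / (1 - ν))) := by positivity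
    linarith

/-- The Mainardi function as a ray integral, in logarithmic coordinates. -/
lemma pi_mul_mainardi_eq {ν : ℝ} (hν : 0 < ν) (hν1 : ν < 1) {φ : ℝ} (hφ : π / 2 < φ)
    (hφ' : φ ≤ π) (x : ℝ) :
    π * mainardi ν x = (∫ u : ℝ, Complex.exp (Complex.exp (u + φ * Complex.I) +
      ν * (u + φ * Complex.I)) *
        Complex.exp (-x * Complex.exp (ν * (u + φ * Complex.I)))).im := by
  have hc : 0 < -Real.cos φ := neg_pos.mpr <|
    Real.cos_neg_of_pi_div_two_lt_of_lt hφ (by linarith [Real.pi_pos])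
  have hz : ∀ n : ℕ, 0 < ν * ((n : ℝ) + 1) := fun n => by positivity
  have key : HasSum
      (fun n : ℕ => ∫ u : ℝ, Complex.exp (Complex.exp (u + φ * Complex.I) +
        (ν * ((n : ℝ) + 1) : ℝ) * (u + φ * Complex.I)) * (((-x) ^ n / n.factorial : ℝ) : ℂ))
      (∫ u : ℝ, Complex.exp (Complex.exp (u + φ * Complex.I) + ν * (u + φ * Complex.I)) *
        Complex.exp (-x * Complex.exp (ν * (u + φ * Complex.I)))) := by
    have hb : ∀ (n : ℕ) (u : ℝ), Real.exp (Real.exp u * Real.cos φ + (ν * ((n : ℝ) + 1)) * u) *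
        (|x| ^ n / n.factorial) = Real.exp (Real.exp u * Real.cos φ + ν * u) *
          ((|x| * Real.exp (ν * u)) ^ n / n.factorial) := by
      intro n u
      rw [mul_pow, ← Real.exp_nat_mul, show Real.exp u * Real.cos φ + (ν * ((n : ℝ) + 1)) * u =
        (Real.exp u * Real.cos φ + ν * u) + n * (ν * u) by ring, Real.exp_add]
      ring
    have hs : ∀ u : ℝ, HasSum (fun n : ℕ => Real.exp (Real.exp u * Real.cos φ +
        (ν * ((n : ℝ) + 1)) * u) * (|x| ^ n / n.factorial))
        (Real.exp (Real.exp u * Real.cos φ + ν * u) * Real.exp (|x| * Real.exp (ν * u))) := by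
      intro u
      simp only [hb]
      refine HasSum.mul_left _ ?_
      have := NormedSpace.expSeries_div_hasSum_exp (𝔸 := ℝ) (|x| * Real.exp (ν * u))
      rwa [← Real.exp_eq_exp_ℝ] at this
    refine hasSum_integral_of_dominated_convergence
      (fun n u => Real.exp (Real.exp u * Real.cos φ + (ν * ((n : ℝ) + 1)) * u) *
        (|x| ^ n / n.factorial)) (fun n => by fun_prop) (fun n => Eventually.of_forall fun u => ?_)
      (Eventually.of_forall fun u => (hs u).summable) ?_ (Eventually.of_forall fun u => ?_)
    · rw [norm_mul, norm_cexp_cexp_add_mul, Complex.norm_real]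
      simp
    · simp only [(hs _).tsum_eq]
      obtain ⟨K, hK⟩ := exists_mul_exp_mul_le hν hν1 (half_pos hc) (abs_nonneg x)
      refine ((integrable_exp_neg_mul_exp_add_mul (half_pos hc) hν).const_mul
        (Real.exp K)).mono' (by fun_prop) (Eventually.of_forall fun u => ?_)
      rw [Real.norm_eq_abs, abs_of_pos (by positivity), ← Real.exp_add, ← Real.exp_add,
        Real.exp_le_exp]
      linarith [hK u]
    · have := NormedSpace.expSeries_div_hasSum_exp (𝔸 := ℂ)
        (-x * Complex.exp (ν * (u + φ * Complex.I)))
      rw [← Complex.exp_eq_exp_ℂ] at this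
      refine (this.mul_left (Complex.exp (Complex.exp (u + φ * Complex.I) +
        ν * (u + φ * Complex.I)))).congr_fun fun n => ?_
      rw [mul_pow, ← Complex.exp_nat_mul]
      push_cast
      rw [show Complex.exp (u + φ * Complex.I) + (ν * ((n : ℂ) + 1)) * (u + φ * Complex.I) =
        (Complex.exp (u + φ * Complex.I) + ν * (u + φ * Complex.I)) +
          n * (ν * (u + φ * Complex.I)) by ring, Complex.exp_add _ (n * _)]
      ring
  have him := Complex.hasSum_im key
  rw [← him.tsum_eq, mainardi, ← tsum_mul_left]
  congr 1
  ext n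
  rw [integral_mul_const, Complex.im_mul_ofReal, im_integral_cexp_cexp_add_mul hφ hφ' (hz n),
    show 1 - ν * ((n : ℝ) + 1) = 1 - ν - ν * n by ring]
  rw [mul_comm (n.factorial : ℝ), ← div_div]
  ring

lemma re_div_norm_mul_le_norm_sq_add_sq {a : ℂ} (ha : a ≠ 0) (s : ℝ) :
    a.re / ‖a‖ * (‖a‖ ^ 2 + s ^ 2) ≤ ‖a ^ 2 + s ^ 2‖ := by
  have hn : 0 < ‖a‖ := norm_pos_iff.mpr ha
  have h : ((a ^ 2 + s ^ 2) * (starRingEnd ℂ) a).re = a.re * (‖a‖ ^ 2 + s ^ 2) := by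
    rw [← Complex.normSq_eq_norm_sq, Complex.normSq_apply]
    simp [pow_two]
    ring
  have h2 := (Complex.re_le_norm ((a ^ 2 + s ^ 2) * (starRingEnd ℂ) a))
  rw [h, norm_mul, RCLike.norm_conj] at h2
  rw [div_mul_eq_mul_div, div_le_iff₀ hn]
  exact h2

lemma integrable_inv_sq_add_sq {A : ℝ} (hA : 0 < A) :
    Integrable fun s : ℝ => (A ^ 2 + s ^ 2)⁻¹ := by
  refine ((integrable_inv_one_add_sq.comp_div hA.ne').const_mul (A ^ 2)⁻¹).congr
    (Eventually.of_forall fun s => ?_)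
  simp only
  rw [← mul_inv]
  congr 1
  field_simp

lemma sq_add_sq_ne_zero {a : ℂ} (ha : 0 < a.re) (s : ℝ) : a ^ 2 + (s : ℂ) ^ 2 ≠ 0 := by
  have h0 : a ≠ 0 := by rintro rfl; simp at ha
  have hn : 0 < ‖a‖ := norm_pos_iff.mpr h0
  have := re_div_norm_mul_le_norm_sq_add_sq h0 s
  rw [← norm_pos_iff]
  refine lt_of_lt_of_le ?_ this
  positivity

lemma norm_inv_sq_add_sq_le {a : ℂ} (ha : 0 < a.re) (s : ℝ) :
    ‖(a ^ 2 + (s : ℂ) ^ 2)⁻¹‖ ≤ ‖a‖ / a.re * (‖a‖ ^ 2 + s ^ 2)⁻¹ := by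
  have h0 : a ≠ 0 := by rintro rfl; simp at ha
  have hn : 0 < ‖a‖ := norm_pos_iff.mpr h0
  rw [norm_inv, show ‖a‖ / a.re * (‖a‖ ^ 2 + s ^ 2)⁻¹ = (a.re / ‖a‖ * (‖a‖ ^ 2 + s ^ 2))⁻¹ by
    rw [mul_inv, inv_div]]
  exact inv_anti₀ (by positivity) (re_div_norm_mul_le_norm_sq_add_sq h0 s)

lemma integrable_inv_sq_add_sq_complex {a : ℂ} (ha : 0 < a.re) :
    Integrable fun s : ℝ => (a ^ 2 + (s : ℂ) ^ 2)⁻¹ := by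
  have h0 : a ≠ 0 := by rintro rfl; simp at ha
  refine ((integrable_inv_sq_add_sq (norm_pos_iff.mpr h0)).const_mul (‖a‖ / a.re)).mono' ?_
    (Eventually.of_forall fun s => norm_inv_sq_add_sq_le ha s)
  exact (Continuous.inv₀ (by fun_prop) (sq_add_sq_ne_zero ha)).aestronglyMeasurable

open scoped FourierTransform in
lemma fourier_cexp_neg_mul_abs {a : ℂ} (ha : 0 < a.re) (ξ : ℝ) :
    𝓕 (fun t : ℝ => Complex.exp (-a * |t|)) ξ =
      2 * a * (a ^ 2 + ((2 * π * ξ : ℝ) : ℂ) ^ 2)⁻¹ := by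
  rw [Real.fourier_real_eq_integral_exp_smul]
  have e1 : EqOn (fun v : ℝ => Complex.exp (↑(-2 * π * v * ξ) * Complex.I) •
      Complex.exp (-a * |v|))
      (fun v : ℝ => Complex.exp ((-a - (2 * π * ξ : ℝ) * Complex.I) * v)) (Ioi 0) := by
    intro v hv
    simp only [abs_of_pos (show 0 < v from hv), smul_eq_mul]
    rw [← Complex.exp_add]
    congr 1; push_cast; ring
  have e2 : EqOn (fun v : ℝ => Complex.exp (↑(-2 * π * v * ξ) * Complex.I) •
      Complex.exp (-a * |v|))
      (fun v : ℝ => Complex.exp ((a - (2 * π * ξ : ℝ) * Complex.I) * v)) (Iic 0) := by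
    intro v hv
    simp only [abs_of_nonpos (show v ≤ 0 from hv), smul_eq_mul]
    rw [← Complex.exp_add]
    congr 1; push_cast; ring
  have r1 : (-a - (2 * π * ξ : ℝ) * Complex.I).re < 0 := by simpa using ha
  have r2 : 0 < (a - (2 * π * ξ : ℝ) * Complex.I).re := by simpa using ha
  rw [← intervalIntegral.integral_Iic_add_Ioi (b := 0)
    ((integrableOn_congr_fun e2 measurableSet_Iic).mpr (integrableOn_exp_mul_complex_Iic r2 0))
    ((integrableOn_congr_fun e1 measurableSet_Ioi).mpr (integrableOn_exp_mul_complex_Ioi r1 0)),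
    setIntegral_congr_fun measurableSet_Ioi e1, setIntegral_congr_fun measurableSet_Iic e2,
    integral_exp_mul_complex_Iic r2, integral_exp_mul_complex_Ioi r1]
  have n1 : -a - (2 * π * ξ : ℝ) * Complex.I ≠ 0 := fun h => by rw [h] at r1; simp at r1
  have n2 : a - (2 * π * ξ : ℝ) * Complex.I ≠ 0 := fun h => by rw [h] at r2; simp at r2
  have n3 := sq_add_sq_ne_zero ha (2 * π * ξ)
  have e3 : a ^ 2 + ((2 * π * ξ : ℝ) : ℂ) ^ 2 = -((-a - (2 * π * ξ : ℝ) * Complex.I) *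
      (a - (2 * π * ξ : ℝ) * Complex.I)) := by
    linear_combination (((2 * π * ξ : ℝ) : ℂ) ^ 2) * Complex.I_sq
  rw [e3]
  simp only [Complex.ofReal_zero, mul_zero, Complex.exp_zero]
  field_simp
  ring

lemma integral_cos_mul_inv_sq_add_sq {a : ℂ} (ha : 0 < a.re) (x : ℝ) :
    ∫ s in Ioi (0 : ℝ), (Real.cos (x * s) : ℂ) * (a ^ 2 + (s : ℂ) ^ 2)⁻¹ =
      π / (2 * a) * Complex.exp (-|x| * a) := by
  have h0 : a ≠ 0 := by rintro rfl; simp at ha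
  have hint : Integrable fun t : ℝ => Complex.exp (-a * |t|) := by
    have h1 : IntegrableOn (fun t : ℝ => Complex.exp (-a * |t|)) (Ioi 0) :=
      (integrableOn_exp_mul_complex_Ioi (a := -a) (by simpa using ha) 0).congr_fun
        (fun t ht => by simp only [abs_of_pos (show 0 < t from ht)]) measurableSet_Ioi
    have h2 : IntegrableOn (fun t : ℝ => Complex.exp (-a * |t|)) (Iic 0) :=
      (integrableOn_exp_mul_complex_Iic (a := a) (by simpa using ha) 0).congr_fun
        (fun t ht => by simp only [abs_of_nonpos (show t ≤ 0 from ht)]; push_cast; ring_nf)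
        measurableSet_Iic
    rw [← integrableOn_univ, ← Iic_union_Ioi (a := (0 : ℝ))]
    exact h2.union h1
  have hg : Integrable fun ξ : ℝ => 2 * a * (a ^ 2 + ((2 * π * ξ : ℝ) : ℂ) ^ 2)⁻¹ :=
    ((integrable_inv_sq_add_sq_complex ha).comp_mul_left' (by positivity : 2 * π ≠ 0)).const_mul _
  have hF : FourierTransform.fourier (fun t : ℝ => Complex.exp (-a * |t|)) =
      fun ξ : ℝ => 2 * a * (a ^ 2 + ((2 * π * ξ : ℝ) : ℂ) ^ 2)⁻¹ :=
    funext fun ξ => fourier_cexp_neg_mul_abs ha ξ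
  have hinv := congrFun (Continuous.fourierInv_fourier_eq
    (f := fun t : ℝ => Complex.exp (-a * |t|)) (by fun_prop) hint (by rw [hF]; exact hg)) x
  rw [hF, Real.fourierInv_eq'] at hinv
  set G : ℝ → ℂ := fun ξ => Complex.exp (↑(2 * π * inner ℝ ξ x) * Complex.I) •
    (2 * a * (a ^ 2 + ((2 * π * ξ : ℝ) : ℂ) ^ 2)⁻¹) with hG
  have hGi : Integrable G := by
    refine hg.mono (by fun_prop) (Eventually.of_forall fun ξ => ?_)
    simp only [hG]
    rw [norm_smul, Complex.norm_exp_ofReal_mul_I, one_mul]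
  have hGn : Integrable fun ξ => G (-ξ) := hGi.comp_neg
  have h1 := integral_comp_neg_Ioi 0 G
  rw [neg_zero] at h1
  rw [← intervalIntegral.integral_Iic_add_Ioi (b := 0) hGi.integrableOn hGi.integrableOn, ← h1,
    ← integral_add hGn.integrableOn hGi.integrableOn] at hinv
  have h2 : ∀ ξ : ℝ, G (-ξ) + G ξ = 4 * a * ((Real.cos (x * (2 * π * ξ)) : ℂ) *
      (a ^ 2 + ((2 * π * ξ : ℝ) : ℂ) ^ 2)⁻¹) := by
    intro ξ
    simp only [hG, smul_eq_mul]
    rw [Complex.ofReal_cos, Complex.cos]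
    have c1 : (↑(2 * π * inner ℝ (-ξ) x) : ℂ) * Complex.I =
      -((x * (2 * π * ξ) : ℝ) : ℂ) * Complex.I := by simp; ring
    have c2 : (↑(2 * π * inner ℝ ξ x) : ℂ) * Complex.I =
      ((x * (2 * π * ξ) : ℝ) : ℂ) * Complex.I := by simp; ring
    rw [c1, c2]
    have c3 : ((2 * π * -ξ : ℝ) : ℂ) ^ 2 = ((2 * π * ξ : ℝ) : ℂ) ^ 2 := by push_cast; ring
    rw [c3]
    ring
  simp only [h2] at hinv
  rw [integral_const_mul, integral_comp_mul_left_Ioi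
    (fun s : ℝ => (Real.cos (x * s) : ℂ) * (a ^ 2 + (s : ℂ) ^ 2)⁻¹) 0 Real.two_pi_pos,
    mul_zero] at hinv
  rw [mul_comm (-((|x| : ℝ) : ℂ)) a, mul_neg, ← neg_mul, ← hinv, Complex.real_smul]
  have : (π : ℂ) ≠ 0 := by exact_mod_cast Real.pi_ne_zero
  push_cast
  field_simp
  norm_num

/-- The imaginary part of the integral of `g` along the upper half of a Hankel contour, in
logarithmic coordinates: the segment from `R` to `R + φ i` followed by the horizontal half-line
issuing from `R + φ i`. -/
noncomputable def hankelIntegral (φ R : ℝ) (g : ℂ → ℂ) : ℝ :=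
  (∫ u in Ioi R, g (u + φ * Complex.I)).im + (∫ y in (0 : ℝ)..φ, g (R + y * Complex.I)).re

lemma integral_im_eq_hankelIntegral {φ R : ℝ} (hφ : 0 ≤ φ) {g : ℂ → ℂ}
    (hg : ∀ w : ℂ, w.im ∈ Icc 0 φ → DifferentiableAt ℂ g w)
    (hreal : ∀ u : ℝ, (g u).im = 0) {C δ : ℝ} (hδ : 0 < δ)
    (hbound : ∀ u ≤ R, ∀ y ∈ Icc 0 φ, ‖g (u + y * Complex.I)‖ ≤ C * Real.exp (δ * u))
    (hint : IntegrableOn (fun u : ℝ => g (u + φ * Complex.I)) (Ioi R)) :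
    (∫ u : ℝ, g (u + φ * Complex.I)).im = hankelIntegral φ R g := by
  have hcont : Continuous fun u : ℝ => g (u + φ * Complex.I) := by
    refine continuous_iff_continuousAt.mpr fun u => ?_
    have h1 : ContinuousAt g (u + φ * Complex.I) := (hg _ (by simpa using hφ)).continuousAt
    exact ContinuousAt.comp (f := fun u : ℝ => (u + φ * Complex.I : ℂ)) h1 (by fun_prop)
  have hleft : IntegrableOn (fun u : ℝ => g (u + φ * Complex.I)) (Iic R) := by
    refine ((integrableOn_exp_mul_Iic hδ R).const_mul C).mono' hcont.aestronglyMeasurable ?_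
    filter_upwards [ae_restrict_mem measurableSet_Iic] with u hu
    exact hbound u hu φ ⟨hφ, le_rfl⟩
  have hrect : ∀ N : ℝ, (∫ u in N..R, g (u + φ * Complex.I)).im =
      (∫ y in (0 : ℝ)..φ, g (R + y * Complex.I)).re -
      (∫ y in (0 : ℝ)..φ, g (N + y * Complex.I)).re := by
    intro N
    have h := Complex.integral_boundary_rect_eq_zero_of_differentiableOn g
      (N : ℂ) (R + φ * Complex.I) (by
        intro w hw
        refine (hg w ?_).differentiableWithinAt
        have := hw.2
        simpa [uIcc_of_le hφ] using this)
    simp only [Complex.add_re, Complex.ofReal_re, Complex.mul_re, Complex.I_re, mul_zero,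
      Complex.ofReal_im, Complex.I_im, mul_one, sub_self, add_zero, Complex.add_im,
      Complex.mul_im, zero_add, Complex.ofReal_zero, zero_mul] at h
    have h0 : (∫ x in N..R, g x).im = 0 := by
      have : ∫ x in N..R, g x = ∫ x in N..R, ((g x).re : ℂ) := by
        congr 1
        ext x
        exact Complex.ext (by simp) (by simp [hreal])
      rw [this, intervalIntegral.integral_ofReal, Complex.ofReal_im]
    have h2 := congrArg Complex.im h
    simp only [Complex.add_im, Complex.sub_im, smul_eq_mul, Complex.I_mul_im, Complex.zero_im,
      h0] at h2
    linarith
  have h0 : Tendsto (fun N : ℝ => ∫ y in (0 : ℝ)..φ, g (N + y * Complex.I)) atBot (𝓝 0) := by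
    have hb : Tendsto (fun u : ℝ => C * Real.exp (δ * u) * |φ - 0|) atBot (𝓝 0) := by
      have := Real.tendsto_exp_atBot.comp (tendsto_id.const_mul_atBot hδ)
      simpa using (this.const_mul C).mul_const |φ - 0|
    refine squeeze_zero_norm' ?_ hb
    filter_upwards [eventually_le_atBot R] with u hu
    refine intervalIntegral.norm_integral_le_of_norm_le_const fun y hy => ?_
    rw [uIoc_of_le hφ] at hy
    exact hbound u hu y ⟨hy.1.le, hy.2⟩
  have hL := (Complex.continuous_im.tendsto _).comp
    (intervalIntegral_tendsto_integral_Iic R hleft tendsto_id)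
  have hR := ((Complex.continuous_re.tendsto _).comp h0).const_sub
    (∫ y in (0 : ℝ)..φ, g (R + y * Complex.I)).re
  have h := tendsto_nhds_unique hL (hR.congr fun N => (hrect N).symm)
  rw [Complex.zero_re, sub_zero] at h
  rw [← intervalIntegral.integral_Iic_add_Ioi hleft hint, Complex.add_im, h, hankelIntegral,
    add_comm]

lemma integrableOn_Ioi_cexp_cexp_add_mul {φ : ℝ} (hc : Real.cos φ < 0) (z R : ℝ) :
    IntegrableOn (fun u : ℝ => Complex.exp (Complex.exp (u + φ * Complex.I) +
      z * (u + φ * Complex.I))) (Ioi R) := by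
  refine (integrableOn_Ioi_exp_neg_mul_exp_add_mul (neg_pos.mpr hc) z R).mono' (by fun_prop)
    (Eventually.of_forall fun u => ?_)
  rw [norm_cexp_cexp_add_mul]
  refine le_of_eq ?_
  congr 1; ring

lemma hankelIntegral_cexp_of_pos {φ z : ℝ} (hφ : π / 2 < φ) (hφ' : φ ≤ π) (hz : 0 < z) (R : ℝ) :
    hankelIntegral φ R (fun w => Complex.exp (Complex.exp w + z * w)) = π / Real.Gamma (1 - z) := by
  have hφ0 : 0 ≤ φ := by linarith [Real.pi_pos]
  have hc : Real.cos φ < 0 :=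
    Real.cos_neg_of_pi_div_two_lt_of_lt hφ (by linarith [Real.pi_pos])
  rw [← im_integral_cexp_cexp_add_mul hφ hφ' hz]
  refine (integral_im_eq_hankelIntegral hφ0 (fun w _ => by fun_prop) (fun u => ?_)
    (C := Real.exp (Real.exp R)) hz (fun u hu y _ => ?_)
    (integrableOn_Ioi_cexp_cexp_add_mul hc z R)).symm
  · rw [← Complex.ofReal_exp, ← Complex.ofReal_mul, ← Complex.ofReal_add, ← Complex.ofReal_exp,
      Complex.ofReal_im]
  · rw [norm_cexp_cexp_add_mul, ← Real.exp_add, Real.exp_le_exp]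
    have h1 : Real.exp u ≤ Real.exp R := Real.exp_le_exp.mpr hu
    nlinarith [Real.cos_le_one y, Real.exp_pos u]

lemma hankelIntegral_cexp_add_one {φ : ℝ} (hc : Real.cos φ < 0) (z R : ℝ) :
    hankelIntegral φ R (fun w => Complex.exp (Complex.exp w + (z + 1 : ℝ) * w)) =
      -z * hankelIntegral φ R (fun w => Complex.exp (Complex.exp w + z * w)) := by
  set k : ℂ → ℂ := fun w => Complex.exp (Complex.exp w + z * w) with hk
  set k' : ℂ → ℂ := fun w => Complex.exp (Complex.exp w + (z + 1 : ℝ) * w) with hk'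
  have hd : ∀ w, HasDerivAt k (k' w + z * k w) w := by
    intro w
    have h := ((Complex.hasDerivAt_exp w).add ((hasDerivAt_id w).const_mul (z : ℂ))).cexp
    refine h.congr_deriv ?_
    simp only [hk, hk', id, Pi.add_apply]
    push_cast
    rw [show Complex.exp w + (z + 1) * w = (Complex.exp w + z * w) + w by ring, Complex.exp_add _ w]
    ring
  have hi := integrableOn_Ioi_cexp_cexp_add_mul hc z R
  have hi' := integrableOn_Ioi_cexp_cexp_add_mul hc (z + 1) R
  have hlim : Tendsto (fun u : ℝ => k (u + φ * Complex.I)) atTop (𝓝 0) := by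
    refine squeeze_zero_norm (fun u => ?_)
      (tendsto_exp_neg_mul_exp_add_mul_atTop (neg_pos.mpr hc) z)
    rw [norm_cexp_cexp_add_mul]
    refine le_of_eq ?_
    congr 1; ring
  have h1 : ∫ u in Ioi R, (k' (u + φ * Complex.I) + z * k (u + φ * Complex.I)) =
      0 - k (R + φ * Complex.I) := by
    refine integral_Ioi_of_hasDerivAt_of_tendsto' (f := fun u : ℝ => k (u + φ * Complex.I))
      (fun u _ => ?_) (hi'.add (hi.const_mul _)) hlim
    have h := (Complex.ofRealCLM.hasDerivAt (x := u)).add_const (φ * Complex.I : ℂ)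
    have := (hd (u + φ * Complex.I)).comp u h
    simpa [Function.comp_def] using this
  have h2 : ∫ y in (0 : ℝ)..φ, (k' (R + y * Complex.I) + z * k (R + y * Complex.I)) * Complex.I =
      k (R + φ * Complex.I) - k (R + (0 : ℝ) * Complex.I) := by
    refine intervalIntegral.integral_eq_sub_of_hasDerivAt
      (f := fun y : ℝ => k (R + y * Complex.I)) (fun y _ => ?_) ?_
    · have h := (Complex.ofRealCLM.hasDerivAt (x := y)).mul_const Complex.I |>.const_add (R : ℂ)
      have := (hd (R + y * Complex.I)).comp y h
      simpa [Function.comp_def] using this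
    · refine Continuous.intervalIntegrable ?_ _ _
      simp only [hk, hk']
      fun_prop
  rw [integral_add hi' (hi.const_mul _), integral_const_mul] at h1
  have c1 : Continuous fun y : ℝ => k' (R + y * Complex.I) := by simp only [hk']; fun_prop
  have c2 : Continuous fun y : ℝ => z * k (R + y * Complex.I) := by simp only [hk]; fun_prop
  rw [intervalIntegral.integral_mul_const, intervalIntegral.integral_add
    (c1.intervalIntegrable _ _) (c2.intervalIntegrable _ _), intervalIntegral.integral_const_mul]
    at h2
  have h3 : (k (R + (0 : ℝ) * Complex.I)).im = 0 := by
    simp only [hk, Complex.ofReal_zero, zero_mul, add_zero]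
    rw [← Complex.ofReal_exp, ← Complex.ofReal_mul, ← Complex.ofReal_add, ← Complex.ofReal_exp,
      Complex.ofReal_im]
  have i1 := congrArg Complex.im h1
  have i2 := congrArg Complex.im h2
  rw [Complex.sub_im, h3, Complex.mul_I_im, Complex.add_re, Complex.re_ofReal_mul] at i2
  rw [Complex.sub_im, Complex.add_im, Complex.im_ofReal_mul, Complex.zero_im] at i1
  simp only [hankelIntegral]
  linarith

lemma continuousAt_hankelIntegral_cexp {φ : ℝ} (hc : Real.cos φ < 0) (R z₀ : ℝ) :
    ContinuousAt (fun z : ℝ =>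
      hankelIntegral φ R (fun w => Complex.exp (Complex.exp w + z * w))) z₀ := by
  unfold hankelIntegral
  refine ContinuousAt.add (Complex.continuous_im.continuousAt.comp ?_)
    (Complex.continuous_re.continuousAt.comp ?_)
  · refine continuousAt_of_dominated (bound := fun u =>
      Real.exp (-(-Real.cos φ) * Real.exp u + (z₀ + 1) * u) +
      Real.exp (-(-Real.cos φ) * Real.exp u + (z₀ - 1) * u))
      (Eventually.of_forall fun z => by fun_prop) ?_
      ((integrableOn_Ioi_exp_neg_mul_exp_add_mul (neg_pos.mpr hc) _ R).add
        (integrableOn_Ioi_exp_neg_mul_exp_add_mul (neg_pos.mpr hc) _ R))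
      (Eventually.of_forall fun u => by fun_prop)
    filter_upwards [Icc_mem_nhds (show z₀ - 1 < z₀ by linarith) (show z₀ < z₀ + 1 by linarith)]
      with z hz
    refine Eventually.of_forall fun u => ?_
    rw [norm_cexp_cexp_add_mul]
    rcases le_total 0 u with hu | hu
    · refine le_add_of_le_of_nonneg (Real.exp_le_exp.mpr ?_) (Real.exp_pos _).le
      nlinarith [hz.2]
    · refine le_add_of_nonneg_of_le (Real.exp_pos _).le (Real.exp_le_exp.mpr ?_)
      nlinarith [hz.1]
  · refine Continuous.continuousAt ?_
    refine intervalIntegral.continuous_parametric_intervalIntegral_of_continuous' ?_ 0 φ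
    fun_prop

/-- Hankel's formula for the reciprocal of the Gamma function. -/
lemma hankelIntegral_cexp {φ : ℝ} (hφ : π / 2 < φ) (hφ' : φ ≤ π) (z R : ℝ) :
    hankelIntegral φ R (fun w => Complex.exp (Complex.exp w + z * w)) = π / Real.Gamma (1 - z) := by
  have hc : Real.cos φ < 0 :=
    Real.cos_neg_of_pi_div_two_lt_of_lt hφ (by linarith [Real.pi_pos])
  obtain ⟨n, hn⟩ := exists_nat_gt (-z)
  have hn' : -(n : ℝ) < z := by linarith
  clear hn
  induction n generalizing z with
  | zero => exact hankelIntegral_cexp_of_pos hφ hφ' (by simpa using hn') R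
  | succ n ih =>
    by_cases hz : z = 0
    · subst hz
      have h1 := (continuousAt_hankelIntegral_cexp hc R 0).tendsto.mono_left
        (nhdsWithin_le_nhds (s := Ioi 0))
      have h2 : ContinuousAt (fun z : ℝ => π / Real.Gamma (1 - z)) 0 := by
        have h3 : ContinuousAt Real.Gamma (1 - 0) := by
          refine (Real.differentiableAt_Gamma fun m => ?_).continuousAt
          have : (0 : ℝ) ≤ m := Nat.cast_nonneg m
          linarith
        refine continuousAt_const.div (ContinuousAt.comp (f := fun z : ℝ => 1 - z) h3 (by fun_prop))
          ?_
        simp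
      refine tendsto_nhds_unique h1 ((h2.tendsto.mono_left
        (nhdsWithin_le_nhds (s := Ioi 0))).congr' ?_)
      filter_upwards [self_mem_nhdsWithin] with z hz
      exact (hankelIntegral_cexp_of_pos hφ hφ' hz R).symm
    · have h1 := ih (z + 1) (by push_cast at hn'; linarith)
      rw [hankelIntegral_cexp_add_one hc] at h1
      have h2 := Real.Gamma_add_one (s := -z) (by simpa using hz)
      rw [show 1 - z = -z + 1 by ring, h2]
      rw [show 1 - (z + 1) = -z by ring] at h1
      rw [← div_div, eq_div_of_mul_eq (neg_ne_zero.mpr hz) ((mul_comm _ _).trans h1)]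
      ring

lemma hasSum_hankelIntegral {φ R q C : ℝ} (hφ : 0 ≤ φ) (hq : 0 ≤ q) (hq1 : q < 1)
    {F : ℕ → ℂ → ℂ} {g : ℂ → ℂ} {b : ℝ → ℝ} (hF : ∀ n, Continuous (F n))
    (hb : IntegrableOn b (Ioi R))
    (hFb : ∀ n, ∀ u ∈ Ioi R, ‖F n (u + φ * Complex.I)‖ ≤ q ^ n * b u)
    (hFC : ∀ n, ∀ y ∈ Icc 0 φ, ‖F n (R + y * Complex.I)‖ ≤ q ^ n * C)
    (hsum : ∀ w : ℂ, R ≤ w.re → HasSum (fun n => F n w) (g w)) :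
    HasSum (fun n => hankelIntegral φ R (F n)) (hankelIntegral φ R g) := by
  have hgeo := summable_geometric_of_lt_one hq hq1
  have h1 : HasSum (fun n => ∫ u in Ioi R, F n (u + φ * Complex.I))
      (∫ u in Ioi R, g (u + φ * Complex.I)) := by
    refine hasSum_integral_of_dominated_convergence (fun n u => q ^ n * b u) (fun n => ?_)
      (fun n => ?_) (Eventually.of_forall fun u => hgeo.mul_right _) ?_ ?_
    · exact ((hF n).comp (by fun_prop)).aestronglyMeasurable
    · filter_upwards [ae_restrict_mem measurableSet_Ioi] with u hu using hFb n u hu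
    · simp_rw [tsum_mul_right]
      exact hb.const_mul _
    · filter_upwards [ae_restrict_mem measurableSet_Ioi] with u hu
      exact hsum _ (by simpa using le_of_lt hu)
  have h2 : HasSum (fun n => ∫ y in (0 : ℝ)..φ, F n (R + y * Complex.I))
      (∫ y in (0 : ℝ)..φ, g (R + y * Complex.I)) := by
    refine intervalIntegral.hasSum_integral_of_dominated_convergence (fun n _ => q ^ n * C)
      (fun n => ?_) (fun n => ?_) (Eventually.of_forall fun u _ => hgeo.mul_right _) ?_ ?_
    · exact ((hF n).comp (by fun_prop)).aestronglyMeasurable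
    · refine Eventually.of_forall fun y hy => hFC n y ?_
      rw [uIoc_of_le hφ] at hy
      exact ⟨hy.1.le, hy.2⟩
    · simp
    · exact Eventually.of_forall fun y _ => hsum _ (by simp)
  exact (Complex.hasSum_im h1).add (Complex.hasSum_re h2)

lemma norm_cexp_ofReal_mul_add_mul_I (ν u y : ℝ) :
    ‖Complex.exp (ν * (u + y * Complex.I))‖ = Real.exp (ν * u) := by
  rw [Complex.norm_exp]
  simp

lemma re_cexp_ofReal_mul_add_mul_I (ν u y : ℝ) :
    (Complex.exp (ν * (u + y * Complex.I))).re = Real.exp (ν * u) * Real.cos (ν * y) := by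
  rw [Complex.exp_re]
  simp

lemma norm_cexp_cexp (u y : ℝ) :
    ‖Complex.exp (Complex.exp (u + y * Complex.I))‖ = Real.exp (Real.exp u * Real.cos y) := by
  simpa using norm_cexp_cexp_add_mul 0 u y

/-- The kernel whose integral over a Hankel contour, in logarithmic coordinates, represents the
Mittag-Leffler function of order `2 * ν` at `-τ ^ 2`. -/
noncomputable def mittagLefflerKernel (ν τ : ℝ) (w : ℂ) : ℂ :=
  Complex.exp (Complex.exp w) *
    (Complex.exp (ν * w) ^ 2 * (Complex.exp (ν * w) ^ 2 + (τ : ℂ) ^ 2)⁻¹)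

lemma norm_mittagLefflerKernel_le {ν y : ℝ} (hy : 0 < Real.cos (ν * y)) (τ u : ℝ) :
    ‖mittagLefflerKernel ν τ (u + y * Complex.I)‖ ≤
      Real.exp (Real.exp u * Real.cos y) * ((Real.cos (ν * y))⁻¹ *
        (Real.exp (ν * u) ^ 2 * (Real.exp (ν * u) ^ 2 + τ ^ 2)⁻¹)) := by
  have hre : 0 < (Complex.exp (ν * (u + y * Complex.I))).re := by
    rw [re_cexp_ofReal_mul_add_mul_I]; positivity
  have h := norm_inv_sq_add_sq_le hre τ
  rw [norm_cexp_ofReal_mul_add_mul_I, re_cexp_ofReal_mul_add_mul_I] at h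
  rw [mittagLefflerKernel, norm_mul, norm_cexp_cexp, norm_mul, norm_pow,
    norm_cexp_ofReal_mul_add_mul_I]
  have he := Real.exp_pos (ν * u)
  refine mul_le_mul_of_nonneg_left ?_ (Real.exp_pos _).le
  refine (mul_le_mul_of_nonneg_left h (by positivity)).trans_eq ?_
  field_simp

lemma differentiableAt_mittagLefflerKernel {ν : ℝ} {w : ℂ} (hw : 0 < Real.cos (ν * w.im)) (τ : ℝ) :
    DifferentiableAt ℂ (mittagLefflerKernel ν τ) w := by
  have hre : 0 < (Complex.exp (ν * w)).re := by
    rw [← Complex.re_add_im w, re_cexp_ofReal_mul_add_mul_I]; positivity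
  have hne := sq_add_sq_ne_zero hre τ
  unfold mittagLefflerKernel
  fun_prop (disch := assumption)

lemma hasSum_mittagLefflerKernel {ν τ : ℝ} {w : ℂ} (hw : τ ^ 2 < Real.exp (2 * ν * w.re)) :
    HasSum (fun n : ℕ => ((-τ ^ 2) ^ n : ℝ) *
      Complex.exp (Complex.exp w + (-(2 * ν * n) : ℝ) * w)) (mittagLefflerKernel ν τ w) := by
  have hE : Complex.exp (2 * ν * w) ≠ 0 := Complex.exp_ne_zero _
  have hnE : ‖Complex.exp (2 * ν * w)‖ = Real.exp (2 * ν * w.re) := by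
    rw [Complex.norm_exp]; simp
  have hr : ‖-(τ : ℂ) ^ 2 * (Complex.exp (2 * ν * w))⁻¹‖ < 1 := by
    rw [norm_mul, norm_neg, norm_inv, hnE, norm_pow, Complex.norm_real, Real.norm_eq_abs, sq_abs,
      ← div_eq_mul_inv, div_lt_one (Real.exp_pos _)]
    exact hw
  have hadd : Complex.exp (2 * ν * w) + (τ : ℂ) ^ 2 ≠ 0 := by
    intro h
    rw [show -(τ : ℂ) ^ 2 = Complex.exp (2 * ν * w) by linear_combination -h, mul_inv_cancel₀ hE] at hr
    simp at hr
  have h := (hasSum_geometric_of_norm_lt_one hr).mul_left (Complex.exp (Complex.exp w))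
  have hsq : Complex.exp (ν * w) ^ 2 = Complex.exp (2 * ν * w) := by
    rw [← Complex.exp_nat_mul]; congr 1; push_cast; ring
  have hK : mittagLefflerKernel ν τ w = Complex.exp (Complex.exp w) *
      (1 - -(τ : ℂ) ^ 2 * (Complex.exp (2 * ν * w))⁻¹)⁻¹ := by
    rw [mittagLefflerKernel, hsq]
    rw [show 1 - -(τ : ℂ) ^ 2 * (Complex.exp (2 * ν * w))⁻¹ =
      (Complex.exp (2 * ν * w) + (τ : ℂ) ^ 2) * (Complex.exp (2 * ν * w))⁻¹ by
        rw [add_mul, mul_inv_cancel₀ hE]; ring, mul_inv, inv_inv,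
      mul_comm (Complex.exp (2 * ν * w))]
  rw [hK]
  refine h.congr_fun fun n => ?_
  rw [Complex.exp_add, mul_pow, ← Complex.exp_neg, ← Complex.exp_nat_mul]
  push_cast
  rw [show (n : ℂ) * -(2 * ν * w) = -(2 * ν * n) * w by ring]
  ring

lemma cos_mul_le_cos_mul_of_mem_Icc {ν φ : ℝ} (hν : 0 < ν) (hνφ : ν * φ < π / 2) {y : ℝ}
    (hy : y ∈ Icc 0 φ) : Real.cos (ν * φ) ≤ Real.cos (ν * y) :=
  Real.cos_le_cos_of_nonneg_of_le_pi (mul_nonneg hν.le hy.1) (by linarith [Real.pi_pos])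
    (mul_le_mul_of_nonneg_left hy.2 hν.le)

lemma pi_mul_mittagLeffler_eq {ν φ : ℝ} (hν : 0 < ν) (hφ : π / 2 < φ) (hφ' : φ ≤ π)
    (hνφ : ν * φ < π / 2) {τ : ℝ} (hτ : 0 < τ) :
    π * mittagLeffler (2 * ν) (-τ ^ 2) =
      (∫ u : ℝ, mittagLefflerKernel ν τ (u + φ * Complex.I)).im := by
  have hφ0 : 0 ≤ φ := by linarith [Real.pi_pos]
  have hc : Real.cos φ < 0 :=
    Real.cos_neg_of_pi_div_two_lt_of_lt hφ (by linarith [Real.pi_pos])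
  have hκ : 0 < Real.cos (ν * φ) :=
    Real.cos_pos_of_mem_Ioo ⟨by nlinarith [Real.pi_pos], hνφ⟩
  have hκy : ∀ y ∈ Icc 0 φ, Real.cos (ν * φ) ≤ Real.cos (ν * y) :=
    fun y hy => cos_mul_le_cos_mul_of_mem_Icc hν hνφ hy
  obtain ⟨R, hR⟩ : ∃ R : ℝ, τ ^ 2 < Real.exp (2 * ν * R) := by
    refine ⟨τ ^ 2 / (2 * ν), ?_⟩
    rw [mul_div_cancel₀ _ (by positivity)]
    linarith [Real.add_one_le_exp (τ ^ 2)]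
  have hcont : Continuous fun u : ℝ => mittagLefflerKernel ν τ (u + φ * Complex.I) := by
    refine continuous_iff_continuousAt.mpr fun u => ?_
    have h1 : ContinuousAt (mittagLefflerKernel ν τ) (u + φ * Complex.I) :=
      (differentiableAt_mittagLefflerKernel (by simpa using hκ) τ).continuousAt
    exact ContinuousAt.comp (f := fun u : ℝ => (u + φ * Complex.I : ℂ)) h1 (by fun_prop)
  have hH : (∫ u : ℝ, mittagLefflerKernel ν τ (u + φ * Complex.I)).im =
      hankelIntegral φ R (mittagLefflerKernel ν τ) := by
    refine integral_im_eq_hankelIntegral hφ0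
      (fun w hw => differentiableAt_mittagLefflerKernel (hκ.trans_le (hκy _ hw)) τ) (fun u => ?_)
      (C := Real.exp (Real.exp R) * ((Real.cos (ν * φ))⁻¹ * (τ ^ 2)⁻¹)) (δ := 2 * ν)
      (by positivity) (fun u hu y hy => ?_) ?_
    · rw [mittagLefflerKernel]
      norm_cast
    · refine (norm_mittagLefflerKernel_le (hκ.trans_le (hκy y hy)) τ u).trans ?_
      have h1 : Real.exp (2 * ν * u) = Real.exp (ν * u) ^ 2 := by
        rw [← Real.exp_nat_mul]; congr 1; push_cast; ring
      rw [h1, mul_assoc, mul_assoc, mul_comm (τ ^ 2)⁻¹]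
      have h2 : Real.exp u * Real.cos y ≤ Real.exp R := by
        nlinarith [Real.cos_le_one y, Real.exp_pos u, Real.exp_le_exp.mpr hu]
      have := hκy y hy
      have hpos := hκ.trans_le this
      gcongr
      nlinarith [sq_nonneg (Real.exp (ν * u))]
    · refine ((integrableOn_Ioi_exp_neg_mul_exp_add_mul (neg_pos.mpr hc) 0 R).mul_const
        (Real.cos (ν * φ))⁻¹).mono' hcont.aestronglyMeasurable (Eventually.of_forall fun u => ?_)
      refine (norm_mittagLefflerKernel_le hκ τ u).trans ?_
      rw [show -(-Real.cos φ) * Real.exp u + 0 * u = Real.exp u * Real.cos φ by ring]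
      refine mul_le_mul_of_nonneg_left ?_ (Real.exp_pos _).le
      refine mul_le_of_le_one_right (by positivity) ?_
      rw [← div_eq_mul_inv, div_le_one (by positivity)]
      linarith [sq_nonneg τ]
  rw [hH]
  have hexp : ∀ u : ℝ, R ≤ u → τ ^ 2 * Real.exp (-(2 * ν * u)) ≤
      τ ^ 2 * Real.exp (-(2 * ν * R)) := by
    intro u hu; gcongr
  have key := hasSum_hankelIntegral (φ := φ) (R := R) (q := τ ^ 2 * Real.exp (-(2 * ν * R)))
    (C := Real.exp (Real.exp R)) (g := mittagLefflerKernel ν τ)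
    (b := fun u => Real.exp (-(-Real.cos φ) * Real.exp u + 0 * u))
    (F := fun n w => ((-τ ^ 2) ^ n : ℝ) * Complex.exp (Complex.exp w + (-(2 * ν * n) : ℝ) * w))
    hφ0 (by positivity) ?_ (fun n => by fun_prop)
    (integrableOn_Ioi_exp_neg_mul_exp_add_mul (neg_pos.mpr hc) 0 R) ?_ ?_ ?_
  · have h2 : ∀ n : ℕ, hankelIntegral φ R (fun w => ((-τ ^ 2) ^ n : ℝ) *
        Complex.exp (Complex.exp w + (-(2 * ν * n) : ℝ) * w)) =
        π * ((-τ ^ 2) ^ n / Real.Gamma (2 * ν * n + 1)) := by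
      intro n
      have := hankelIntegral_cexp hφ hφ' (-(2 * ν * n)) R
      rw [show 1 - -(2 * ν * n) = 2 * ν * n + 1 by ring] at this
      rw [mul_div_left_comm, ← this, hankelIntegral, hankelIntegral, integral_const_mul,
        intervalIntegral.integral_const_mul, Complex.im_ofReal_mul, Complex.re_ofReal_mul]
      ring
    simp_rw [h2] at key
    rw [← key.tsum_eq, tsum_mul_left, mittagLeffler]
  · rw [Real.exp_neg, ← div_eq_mul_inv, div_lt_one (Real.exp_pos _)]
    exact hR
  · intro n u hu
    have hu' := hexp u (le_of_lt hu)
    rw [norm_mul, norm_cexp_cexp_add_mul, Complex.norm_real, norm_pow, norm_neg, Real.norm_eq_abs,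
      abs_of_nonneg (by positivity : (0 : ℝ) ≤ τ ^ 2)]
    calc (τ ^ 2) ^ n * Real.exp (Real.exp u * Real.cos φ + -(2 * ν * n) * u)
        = (τ ^ 2 * Real.exp (-(2 * ν * u))) ^ n *
          Real.exp (-(-Real.cos φ) * Real.exp u + 0 * u) := by
          rw [mul_pow, ← Real.exp_nat_mul, mul_assoc ((τ ^ 2) ^ n), ← Real.exp_add]
          congr 2; ring
      _ ≤ _ := by gcongr
  · intro n y hy
    rw [norm_mul, norm_cexp_cexp_add_mul, Complex.norm_real, norm_pow, norm_neg, Real.norm_eq_abs,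
      abs_of_nonneg (by positivity : (0 : ℝ) ≤ τ ^ 2)]
    calc (τ ^ 2) ^ n * Real.exp (Real.exp R * Real.cos y + -(2 * ν * n) * R)
        = (τ ^ 2 * Real.exp (-(2 * ν * R))) ^ n * Real.exp (Real.exp R * Real.cos y) := by
          rw [mul_pow, ← Real.exp_nat_mul, mul_assoc ((τ ^ 2) ^ n), ← Real.exp_add]
          congr 2; ring
      _ ≤ _ := by
          gcongr
          nlinarith [Real.cos_le_one y, Real.exp_pos R]
  · intro w hw
    exact hasSum_mittagLefflerKernel (hR.trans_le (by gcongr))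

lemma integral_Ioi_inv_sq_add_sq {A : ℝ} (hA : 0 < A) :
    ∫ s in Ioi (0 : ℝ), (A ^ 2 + s ^ 2)⁻¹ = π / (2 * A) := by
  have h := integral_cos_mul_inv_sq_add_sq (a := A) (by simpa using hA) 0
  simp only [zero_mul, Real.cos_zero, Complex.ofReal_one, one_mul, abs_zero, Complex.ofReal_zero,
    neg_zero, Complex.exp_zero, mul_one] at h
  exact_mod_cast h

lemma integrable_prod_mittagLefflerKernel_mul_cos {ν φ : ℝ} (hν : 0 < ν)
    (hc : Real.cos φ < 0) (hκ : 0 < Real.cos (ν * φ)) (x : ℝ) :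
    Integrable (fun p : ℝ × ℝ => mittagLefflerKernel ν p.1 (p.2 + φ * Complex.I) *
      (Real.cos (x * p.1) : ℂ)) ((volume.restrict (Ioi 0)).prod volume) := by
  have hre : ∀ u : ℝ, 0 < (Complex.exp (ν * (u + φ * Complex.I))).re := fun u => by
    rw [re_cexp_ofReal_mul_add_mul_I]; positivity
  have hcont : Continuous (fun p : ℝ × ℝ => mittagLefflerKernel ν p.1 (p.2 + φ * Complex.I) *
      (Real.cos (x * p.1) : ℂ)) := by
    have hne : ∀ p : ℝ × ℝ, Complex.exp (ν * (p.2 + φ * Complex.I)) ^ 2 + (p.1 : ℂ) ^ 2 ≠ 0 :=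
      fun p => sq_add_sq_ne_zero (hre p.2) p.1
    unfold mittagLefflerKernel
    refine ((Continuous.mul (by fun_prop) ((by fun_prop : Continuous _).mul
      (Continuous.inv₀ (by fun_prop) hne))).mul (by fun_prop))
  have hle : ∀ u τ : ℝ, ‖mittagLefflerKernel ν τ (u + φ * Complex.I) * (Real.cos (x * τ) : ℂ)‖ ≤
      Real.exp (Real.exp u * Real.cos φ) * (Real.cos (ν * φ))⁻¹ * Real.exp (ν * u) ^ 2 *
        (Real.exp (ν * u) ^ 2 + τ ^ 2)⁻¹ := by
    intro u τ
    rw [norm_mul, Complex.norm_real, Real.norm_eq_abs]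
    refine (mul_le_of_le_one_right (norm_nonneg _) (Real.abs_cos_le_one _)).trans ?_
    refine (norm_mittagLefflerKernel_le hκ τ u).trans_eq ?_
    ring
  have hbi : ∀ u : ℝ, Integrable (fun τ : ℝ => Real.exp (Real.exp u * Real.cos φ) *
      (Real.cos (ν * φ))⁻¹ * Real.exp (ν * u) ^ 2 * (Real.exp (ν * u) ^ 2 + τ ^ 2)⁻¹)
      (volume.restrict (Ioi 0)) := fun u =>
    ((integrable_inv_sq_add_sq (Real.exp_pos (ν * u))).const_mul _).integrableOn
  have hi : ∀ u : ℝ, Integrable (fun τ : ℝ => mittagLefflerKernel ν τ (u + φ * Complex.I) *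
      (Real.cos (x * τ) : ℂ)) (volume.restrict (Ioi 0)) := fun u =>
    (hbi u).mono' (hcont.comp (by fun_prop : Continuous fun τ : ℝ => (τ, u))).aestronglyMeasurable
      (Eventually.of_forall fun τ => hle u τ)
  refine (integrable_prod_iff' hcont.aestronglyMeasurable).mpr
    ⟨Eventually.of_forall hi, ?_⟩
  refine ((integrable_exp_neg_mul_exp_add_mul (neg_pos.mpr hc) hν).const_mul
    ((Real.cos (ν * φ))⁻¹ * (π / 2))).mono'
    hcont.norm.aestronglyMeasurable.prod_swap.integral_prod_right' (Eventually.of_forall fun u => ?_)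
  rw [Real.norm_eq_abs, abs_of_nonneg (integral_nonneg fun _ => norm_nonneg _)]
  refine (integral_mono (hi u).norm (hbi u) (hle u)).trans_eq ?_
  have he := Real.exp_pos (ν * u)
  rw [integral_const_mul, integral_Ioi_inv_sq_add_sq he, Real.exp_add]
  rw [show -(-Real.cos φ) * Real.exp u = Real.exp u * Real.cos φ by ring]
  field_simp

lemma integral_mittagLefflerKernel_mul_cos {ν φ : ℝ} (hκ : 0 < Real.cos (ν * φ)) (x u : ℝ) :
    ∫ τ in Ioi (0 : ℝ), mittagLefflerKernel ν τ (u + φ * Complex.I) * (Real.cos (x * τ) : ℂ) =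
      ((π / 2 : ℝ) : ℂ) * (Complex.exp (Complex.exp (u + φ * Complex.I) + ν * (u + φ * Complex.I)) *
        Complex.exp (-|x| * Complex.exp (ν * (u + φ * Complex.I)))) := by
  have hre : 0 < (Complex.exp (ν * (u + φ * Complex.I))).re := by
    rw [re_cexp_ofReal_mul_add_mul_I]; positivity
  have hE := Complex.exp_ne_zero (ν * (u + φ * Complex.I))
  have h := integral_cos_mul_inv_sq_add_sq hre x
  rw [Complex.exp_add]
  calc _ = ∫ τ in Ioi (0 : ℝ), Complex.exp (Complex.exp (u + φ * Complex.I)) *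
        Complex.exp (ν * (u + φ * Complex.I)) ^ 2 * ((Real.cos (x * τ) : ℂ) *
          (Complex.exp (ν * (u + φ * Complex.I)) ^ 2 + (τ : ℂ) ^ 2)⁻¹) := by
        refine integral_congr_ae (Eventually.of_forall fun τ => ?_)
        simp only [mittagLefflerKernel]
        ring
    _ = _ := by
        rw [integral_const_mul, h]
        push_cast
        field_simp

theorem mainardi_cosine_transform (ν : ℝ) (hν0 : 1 / 2 ≤ ν) (hν1 : ν < 1) (x : ℝ) :
    IntegrableOn (fun τ : ℝ => mittagLeffler (2 * ν) (-τ ^ 2) * Real.cos (x * τ)) (Ioi 0) ∧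
    (1 / 2) * mainardi ν |x| =
      (1 / π) * ∫ τ in Ioi (0 : ℝ), mittagLeffler (2 * ν) (-τ ^ 2) * Real.cos (x * τ) := by
  have hν : 0 < ν := by linarith
  have hπ := Real.pi_pos
  obtain ⟨φ, hφ, hφν⟩ : ∃ φ : ℝ, π / 2 < φ ∧ φ < π / 2 / ν :=
    exists_between (by rw [lt_div_iff₀ hν]; nlinarith)
  have hνφ : ν * φ < π / 2 := by rwa [lt_div_iff₀ hν, mul_comm] at hφν
  have hφ' : φ ≤ π := by nlinarith
  have hc : Real.cos φ < 0 := Real.cos_neg_of_pi_div_two_lt_of_lt hφ (by linarith)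
  have hκ : 0 < Real.cos (ν * φ) := Real.cos_pos_of_mem_Ioo ⟨by nlinarith, hνφ⟩
  have hF := integrable_prod_mittagLefflerKernel_mul_cos hν hc hκ x
  have hE : ∀ τ ∈ Ioi (0 : ℝ), (∫ u : ℝ, mittagLefflerKernel ν τ (u + φ * Complex.I) *
      (Real.cos (x * τ) : ℂ)).im = π * (mittagLeffler (2 * ν) (-τ ^ 2) * Real.cos (x * τ)) := by
    intro τ hτ
    rw [integral_mul_const, Complex.im_mul_ofReal,
      ← pi_mul_mittagLeffler_eq hν hφ hφ' hνφ hτ, mul_assoc]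
  have hint := hF.integral_prod_left
  have hswap := congrArg Complex.im (integral_integral_swap (f := fun τ u : ℝ =>
    mittagLefflerKernel ν τ (u + φ * Complex.I) * (Real.cos (x * τ) : ℂ)) hF)
  simp_rw [integral_mittagLefflerKernel_mul_cos hκ x] at hswap
  have him : (∫ τ in Ioi (0 : ℝ), ∫ u : ℝ, mittagLefflerKernel ν τ (u + φ * Complex.I) *
      (Real.cos (x * τ) : ℂ)).im =
      ∫ τ in Ioi (0 : ℝ), π * (mittagLeffler (2 * ν) (-τ ^ 2) * Real.cos (x * τ)) := by
    rw [← setIntegral_congr_fun measurableSet_Ioi hE]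
    exact (Complex.imCLM.integral_comp_comm hint).symm
  rw [him, integral_const_mul, integral_const_mul, Complex.im_ofReal_mul,
    ← pi_mul_mainardi_eq hν hν1 hφ hφ' |x|] at hswap
  refine ⟨?_, ?_⟩
  · have h1 : IntegrableOn (fun τ : ℝ => π * (mittagLeffler (2 * ν) (-τ ^ 2) *
        Real.cos (x * τ))) (Ioi 0) :=
      IntegrableOn.congr_fun hint.im hE measurableSet_Ioi
    refine (h1.const_mul π⁻¹).congr (Eventually.of_forall fun τ => ?_)
    simp only
    rw [inv_mul_cancel_left₀ hπ.ne']
  · field_simp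
    field_simp at hswap
    linarith
end
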